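/- arXiv:2308.14069 — 2 statements merged into one kernel-verified Lean document; each statement's English description precedes it below -/
import Mathlib

section
/- There is an absolute constant c > 0 such that for every prime p and every integer h ≥ 2·log p one has |R ∩ (R−1) ∩ (R−2) ∩ … ∩ (R−h)| ≤ c · √p · (log p)² · (log(4h / log p))² · δ_p(h) / h. -/
open Finset Pointwise

/-- The set of nonzero quadratic residues in `F_p`. -/
def quadRes (p : ℕ) [Fact p.Prime] : Finset (ZMod p) :=
  Finset.univ.filter fun x => ∃ y : ZMod p, y ≠ 0 ∧ y ^ 2 = x

/-- `R ∩ (R−1) ∩ … ∩ (R−h)`:  the elements `x` with `x + j ∈ R` for all `j = 0,1,…,h`. -/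
def RplusSeg (p : ℕ) [Fact p.Prime] (h : ℕ) : Finset (ZMod p) :=
  (quadRes p).filter fun x => ∀ j ∈ Finset.Icc 1 h, x + (j : ZMod p) ∈ quadRes p

/-- The function `δ_p(h)` (all logarithms base 2). -/
noncomputable def deltaP (p h : ℕ) : ℝ :=
  if (h : ℝ) ≤ 2 * Real.logb 2 p then 1
  else if (h : ℝ) ≤ (Real.logb 2 p) ^ 2 then (h : ℝ) / Real.logb 2 p
  else Real.logb 2 p

section Stepanov

open Polynomial

/-- The numerators of the iterated derivatives of `f ^ s * A`: the `n`-th derivative is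
`f ^ (s - n)` times the value of this operator at `A`. -/
noncomputable def derivNumerator {K : Type*} [Field K] (f : K[X]) (s : K) : ℕ → K[X] →ₗ[K] K[X]
  | 0 => LinearMap.id
  | n + 1 => (LinearMap.mulLeft K (C (s - n) * derivative f) +
      LinearMap.mulLeft K f ∘ₗ derivative) ∘ₗ derivNumerator f s n

lemma derivNumerator_succ {K : Type*} [Field K] (f : K[X]) (s : K) (n : ℕ) (A : K[X]) :
    derivNumerator f s (n + 1) A = C (s - n) * derivative f * derivNumerator f s n A +
      f * derivative (derivNumerator f s n A) := by
  simp [derivNumerator, mul_assoc]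

lemma iterate_derivative_pow_mul {K : Type*} [Field K] {f g c : K[X]} {e : K}
    (hg : f * derivative g = C e * derivative f * g) (hc : derivative c = 0) (M : ℕ) (A : K[X])
    {n : ℕ} (hn : n ≤ M) :
    derivative^[n] (f ^ M * (A * g * c)) =
      f ^ (M - n) * (derivNumerator f (M + e) n A * g * c) := by
  induction n with
  | zero => simp [derivNumerator]
  | succ n ih =>
    rw [Function.iterate_succ_apply', ih (by omega), derivNumerator_succ]
    obtain ⟨k, rfl⟩ : ∃ k, M = n + 1 + k := ⟨M - (n + 1), by omega⟩
    have h1 : n + 1 + k - n = k + 1 := by omega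
    have h2 : n + 1 + k - (n + 1) = k := by omega
    rw [h1, h2]
    simp only [derivative_mul, derivative_pow_succ, hc]
    have h3 : C (((n + 1 + k : ℕ) : K) + e - n) = C ((k : K) + 1) + C e := by
      rw [← C_add]; congr 1; push_cast; ring
    rw [h3]
    linear_combination (f ^ k * derivNumerator f (((n + 1 + k : ℕ) : K) + e) n A * c) * hg

lemma mul_mem_degreeLT {K : Type*} [Field K] {a b : ℕ} {P Q : K[X]} (hP : P ∈ degreeLT K a)
    (hQ : Q.natDegree ≤ b) : Q * P ∈ degreeLT K (a + b) := by
  rw [mem_degreeLT] at *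
  by_cases h : Q * P = 0
  · rw [h, degree_zero]; exact WithBot.bot_lt_coe _
  · have hP0 : P ≠ 0 := right_ne_zero_of_mul h
    rw [← natDegree_lt_iff_degree_lt hP0] at hP
    rw [← natDegree_lt_iff_degree_lt h]
    exact natDegree_mul_le.trans_lt (by omega)

lemma degreeLT_le {K : Type*} [Field K] {a b : ℕ} (h : a ≤ b) {P : K[X]}
    (hP : P ∈ degreeLT K a) : P ∈ degreeLT K b := degreeLT_mono h hP

lemma derivNumerator_mem {K : Type*} [Field K] {f : K[X]} {m : ℕ} (hf : f.natDegree ≤ m) (s : K)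
    {a : ℕ} {A : K[X]} (hA : A ∈ degreeLT K a) (n : ℕ) :
    derivNumerator f s n A ∈ degreeLT K (a + n * m) := by
  induction n with
  | zero => simpa [derivNumerator] using hA
  | succ n ih =>
    have hd : derivative (derivNumerator f s n A) ∈ degreeLT K (a + n * m) := by
      rw [mem_degreeLT] at *
      exact (degree_derivative_le).trans_lt ih
    have e : a + (n + 1) * m = a + n * m + m := by ring
    rw [derivNumerator_succ, e]
    refine Submodule.add_mem _ (mul_mem_degreeLT ih ?_) (mul_mem_degreeLT hd hf)
    refine (natDegree_C_mul_le _ _).trans ((natDegree_derivative_le f).trans (by omega))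

lemma eq_zero_of_sq_mul_eq {K : Type*} [Field K] {f A B : K[X]} {c r : K} (hc : c ≠ 0)
    (hr : f.rootMultiplicity r = 1) (h : A ^ 2 * f = C c * B ^ 2) : A = 0 ∧ B = 0 := by
  have hf : f ≠ 0 := by rintro rfl; simp at hr
  by_cases hA : A = 0
  · subst hA
    simpa [hc] using h.symm
  · exfalso
    have hl : A ^ 2 * f ≠ 0 := mul_ne_zero (pow_ne_zero _ hA) hf
    have hB : B ≠ 0 := by rintro rfl; simp [hA, hf] at h
    have h1 := congrArg (rootMultiplicity r) h
    rw [rootMultiplicity_mul hl, rootMultiplicity_mul (h ▸ hl), hr, rootMultiplicity_C,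
      pow_two, pow_two, rootMultiplicity_mul (mul_ne_zero hA hA),
      rootMultiplicity_mul (mul_ne_zero hB hB)] at h1
    omega

lemma eq_of_X_pow_dvd_sub {K : Type*} [Field K] {n : ℕ} {P Q : K[X]} (hP : P ∈ degreeLT K n)
    (hQ : Q ∈ degreeLT K n) (h : X ^ n ∣ P - Q) : P = Q := by
  refine sub_eq_zero.mp (eq_zero_of_dvd_of_degree_lt h ?_)
  rw [degree_X_pow]
  exact mem_degreeLT.mp (Submodule.sub_mem _ hP hQ)

lemma sq_mem_degreeLT {K : Type*} [Field K] {a n m : ℕ} {A Q : K[X]} (hA : A ∈ degreeLT K a)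
    (hQ : Q.natDegree ≤ m) (h : 2 * a + m ≤ n) : Q * A ^ 2 ∈ degreeLT K n := by
  by_cases hA0 : A = 0
  · simp [hA0]
  have : A.natDegree < a := (natDegree_lt_iff_degree_lt hA0).2 (mem_degreeLT.mp hA)
  rw [pow_two, ← mul_assoc]
  refine degreeLT_le (a := a + (m + a)) (by omega) (mul_mem_degreeLT hA ?_)
  exact natDegree_mul_le.trans (by omega)

variable {p : ℕ} [Fact p.Prime]

lemma eq_zero_of_sum_expand_eq_zero (hp : p ≠ 2) {f : (ZMod p)[X]} {m a : ℕ}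
    (hf : f.natDegree ≤ m) (hf0 : f.eval 0 ≠ 0) {r : ZMod p} (hr : f.rootMultiplicity r = 1)
    (ham : 2 * a + m ≤ p) (J : ℕ) (A B : ℕ → (ZMod p)[X])
    (hA : ∀ j, A j ∈ degreeLT (ZMod p) a) (hB : ∀ j, B j ∈ degreeLT (ZMod p) a)
    (h : ∑ j ∈ range J, (A j + B j * f ^ ((p - 1) / 2)) * X ^ (j * p) = 0) :
    ∀ j < J, A j = 0 ∧ B j = 0 := by
  induction J generalizing A B with
  | zero => simp
  | succ J ih =>
    have hpp : p.Prime := Fact.out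
    have hodd : (p - 1) / 2 + (p - 1) / 2 + 1 = p := by
      have := hpp.eq_two_or_odd; have := hpp.two_le; omega
    set g := f ^ ((p - 1) / 2) with hg
    have hgf : g ^ 2 * f = f ^ p := by
      rw [hg, pow_two, ← pow_add, ← pow_succ, hodd]
    set S := ∑ j ∈ range J, (A (j + 1) + B (j + 1) * g) * X ^ (j * p) with hS
    set S0 := ∑ j ∈ range J, A (j + 1) * X ^ (j * p) with hS0
    set S1 := ∑ j ∈ range J, B (j + 1) * X ^ (j * p) with hS1
    have hSS : S = S0 + g * S1 := by
      rw [hS, hS0, hS1, mul_sum, ← sum_add_distrib]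
      exact sum_congr rfl fun j _ => by ring
    have hsum : A 0 + B 0 * g + X ^ p * S = 0 := by
      rw [sum_range_succ', zero_mul, pow_zero, mul_one] at h
      have hshift : X ^ p * S =
          ∑ j ∈ range J, (A (j + 1) + B (j + 1) * g) * X ^ ((j + 1) * p) := by
        rw [hS, mul_sum]
        exact sum_congr rfl fun j _ => by ring
      rw [hshift, add_comm]
      exact h
    have hfp : X ^ p ∣ f ^ p - C (f.eval 0) := by
      have : f ^ p - C (f.eval 0) = (f - C (f.eval 0)) ^ p := by
        rw [sub_pow_char, ← C_pow, ZMod.pow_card]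
      rw [this]
      refine pow_dvd_pow_of_dvd ?_ p
      rw [X_dvd_iff, coeff_sub, coeff_C_zero, coeff_zero_eq_eval_zero, sub_self]
    obtain ⟨w, hw⟩ := hfp
    have key : A 0 ^ 2 * f = C (f.eval 0) * B 0 ^ 2 := by
      refine eq_of_X_pow_dvd_sub (n := p) ?_ ?_ ?_
      · rw [mul_comm]; exact sq_mem_degreeLT (hA 0) hf ham
      · exact sq_mem_degreeLT (hB 0) (natDegree_C _).le (by omega : 2 * a + 0 ≤ p)
      · have e1 : A 0 + X ^ p * S0 = -(g * (B 0 + X ^ p * S1)) := by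
          rw [hSS] at hsum; linear_combination hsum
        have e2 : (A 0 + X ^ p * S0) ^ 2 * f = f ^ p * (B 0 + X ^ p * S1) ^ 2 := by
          rw [e1, ← hgf]; ring
        refine ⟨w * B 0 ^ 2 + f ^ p * (2 * B 0 * S1 + X ^ p * S1 ^ 2)
          - f * (2 * A 0 * S0 + X ^ p * S0 ^ 2), ?_⟩
        linear_combination e2 + (B 0 ^ 2) * hw
    obtain ⟨hA0, hB0⟩ := eq_zero_of_sq_mul_eq hf0 hr key
    have hS' : S = 0 := by
      rw [hA0, hB0] at hsum
      simpa using hsum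
    intro j hj
    cases j with
    | zero => exact ⟨hA0, hB0⟩
    | succ j =>
      exact ih (fun j => A (j + 1)) (fun j => B (j + 1)) (fun j => hA _) (fun j => hB _) hS' j
        (by omega)

lemma exists_auxiliary_coefficients (f : (ZMod p)[X]) {m : ℕ} (hf : f.natDegree ≤ m)
    (s t ε : ZMod p) {a J M : ℕ} (hdim : M * (a + M * m + J) < 2 * a * J) :
    ∃ A B : ℕ → (ZMod p)[X], (∀ j, A j ∈ degreeLT (ZMod p) a) ∧
      (∀ j, B j ∈ degreeLT (ZMod p) a) ∧ (∃ j < J, A j ≠ 0 ∨ B j ≠ 0) ∧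
      ∀ n < M, ∑ j ∈ range J, X ^ j *
        (derivNumerator f s n (A j) + C ε * derivNumerator f t n (B j)) = 0 := by
  let V := degreeLT (ZMod p) a
  let W := degreeLT (ZMod p) (a + M * m + J)
  have hfin : ∀ n, Module.finrank (ZMod p) (degreeLT (ZMod p) n) = n := fun n => by
    rw [(degreeLTEquiv (ZMod p) n).finrank_eq]; simp
  have hV : FiniteDimensional (ZMod p) V := (degreeLTEquiv (ZMod p) _).symm.finiteDimensional
  have hW : FiniteDimensional (ZMod p) W := (degreeLTEquiv (ZMod p) _).symm.finiteDimensional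
  let Φ₀ (n : Fin M) : ((Fin J → V) × (Fin J → V)) →ₗ[ZMod p] (ZMod p)[X] :=
    ∑ j : Fin J, LinearMap.mulLeft (ZMod p) (X ^ (j : ℕ)) ∘ₗ
      (derivNumerator f s n ∘ₗ V.subtype ∘ₗ LinearMap.proj j ∘ₗ LinearMap.fst _ _ _ +
        LinearMap.mulLeft (ZMod p) (C ε) ∘ₗ derivNumerator f t n ∘ₗ V.subtype ∘ₗ
          LinearMap.proj j ∘ₗ LinearMap.snd _ _ _)
  have hΦ₀ : ∀ n v, Φ₀ n v = ∑ j : Fin J, X ^ (j : ℕ) *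
      (derivNumerator f s n (v.1 j) + C ε * derivNumerator f t n (v.2 j)) := by
    intro n v
    simp only [Φ₀, LinearMap.sum_apply]
    rfl
  have hmem : ∀ n v, Φ₀ n v ∈ W := by
    intro n v
    rw [hΦ₀]
    refine Submodule.sum_mem _ fun j _ => ?_
    have hn : (n : ℕ) * m ≤ M * m := Nat.mul_le_mul_right _ n.2.le
    refine degreeLT_le (a := a + n * m + J) (by omega) (mul_mem_degreeLT ?_ ?_)
    · refine Submodule.add_mem _ (derivNumerator_mem hf s (v.1 j).2 n) ?_
      have := mul_mem_degreeLT (derivNumerator_mem hf t (v.2 j).2 n) (natDegree_C ε).le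
      simpa using this
    · simp
  let Φ : ((Fin J → V) × (Fin J → V)) →ₗ[ZMod p] (Fin M → W) :=
    LinearMap.pi fun n => (Φ₀ n).codRestrict W (hmem n)
  have hker : LinearMap.ker Φ ≠ ⊥ := by
    apply LinearMap.ker_ne_bot_of_finrank_lt
    rw [Module.finrank_prod, Module.finrank_pi_fintype, Module.finrank_pi_fintype]
    simp only [V, W, hfin, sum_const, card_univ, Fintype.card_fin, smul_eq_mul]
    linarith
  obtain ⟨v, hv, hv0⟩ := Submodule.exists_mem_ne_zero_of_ne_bot hker
  refine ⟨fun j => if h : j < J then (v.1 ⟨j, h⟩ : (ZMod p)[X]) else 0,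
    fun j => if h : j < J then (v.2 ⟨j, h⟩ : (ZMod p)[X]) else 0, ?_, ?_, ?_, ?_⟩
  · intro j; dsimp only; split_ifs with h
    · exact (v.1 ⟨j, h⟩).2
    · exact Submodule.zero_mem _
  · intro j; dsimp only; split_ifs with h
    · exact (v.2 ⟨j, h⟩).2
    · exact Submodule.zero_mem _
  · by_contra! hcon
    apply hv0
    ext j : 2
    · have := (hcon j j.2).1
      simpa using this
    · have := (hcon j j.2).2
      simpa using this
  · intro n hn
    have h1 : Φ₀ ⟨n, hn⟩ v = 0 := by
      have := congrFun (LinearMap.mem_ker.mp hv) ⟨n, hn⟩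
      exact congrArg Subtype.val this
    rw [hΦ₀] at h1
    refine Eq.trans ?_ h1
    rw [← Fin.sum_univ_eq_sum_range (fun j => X ^ j * (derivNumerator f s n
      (if h : j < J then (v.1 ⟨j, h⟩ : (ZMod p)[X]) else 0) + C ε * derivNumerator f t n
      (if h : j < J then (v.2 ⟨j, h⟩ : (ZMod p)[X]) else 0)))]
    exact sum_congr rfl fun j _ => by simp

lemma card_mul_le_natDegree {K : Type*} [Field K] [DecidableEq K] (P : K[X])
    (N : Finset K) (M : ℕ) (h : ∀ t ∈ N, M ≤ P.rootMultiplicity t) : #N * M ≤ P.natDegree := by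
  calc #N * M = ∑ t ∈ N, M := by simp
    _ ≤ ∑ t ∈ N, P.roots.count t := sum_le_sum fun t ht => by simpa using h t ht
    _ ≤ ∑ t ∈ N ∪ P.roots.toFinset, P.roots.count t :=
        sum_le_sum_of_subset subset_union_left
    _ = P.roots.card := Multiset.sum_count_eq_card fun t ht => by
        simp only [mem_union, Multiset.mem_toFinset]; exact Or.inr ht
    _ ≤ P.natDegree := card_roots' P

theorem stepanov_bound (hp : p ≠ 2) {f : (ZMod p)[X]} {m : ℕ} (hf : f.natDegree ≤ m)
    (hf0 : f.eval 0 ≠ 0) {r : ZMod p} (hr : f.rootMultiplicity r = 1) (ε : ZMod p) {a J M : ℕ}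
    (hM : M ≤ p) (ham : 2 * a + m ≤ p) (hdim : M * (a + M * m + J) < 2 * a * J) :
    #{t : ZMod p | f.eval t ^ ((p - 1) / 2) = ε} * M ≤
      M * m + a + m * ((p - 1) / 2) + J * p := by
  set g := f ^ ((p - 1) / 2) with hg
  set e : ZMod p := (((p - 1) / 2 : ℕ) : ZMod p) with he
  obtain ⟨A, B, hA, hB, ⟨j₀, hj₀, hne⟩, hzero⟩ :=
    exists_auxiliary_coefficients f hf (M + 0) (M + e) ε hdim
  set Ψ₀ := ∑ j ∈ range J, (A j + B j * g) * X ^ (j * p) with hΨ₀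
  have hΨ₀ne : Ψ₀ ≠ 0 := fun h0 => by
    have := eq_zero_of_sum_expand_eq_zero hp hf hf0 hr ham J A B hA hB h0 j₀ hj₀
    tauto
  have hfne : f ≠ 0 := by rintro rfl; simp at hr
  set Ψ := f ^ M * Ψ₀ with hΨ
  have hΨne : Ψ ≠ 0 := mul_ne_zero (pow_ne_zero _ hfne) hΨ₀ne
  have hgd : f * derivative g = C e * derivative f * g := by
    rw [hg, derivative_pow, ← he]
    rcases Nat.eq_zero_or_pos ((p - 1) / 2) with h0 | h0
    · simp [he, h0]
    · rw [← Nat.succ_pred_eq_of_pos h0]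
      simp only [Nat.succ_eq_add_one, Nat.add_sub_cancel, pow_succ]
      ring
  have hXd : ∀ j : ℕ, derivative ((X : (ZMod p)[X]) ^ (j * p)) = 0 := by
    intro j; rw [derivative_X_pow]; simp
  have hroot : ∀ t ∈ ({t : ZMod p | f.eval t ^ ((p - 1) / 2) = ε} : Finset (ZMod p)),
      M ≤ Ψ.rootMultiplicity t := by
    intro t ht
    have hgt : g.eval t = ε := by simpa [hg] using ht
    rcases Nat.eq_zero_or_pos M with hM0 | hM0
    · omega
    suffices M - 1 < Ψ.rootMultiplicity t by omega
    refine lt_rootMultiplicity_of_isRoot_iterate_derivative_of_mem_nonZeroDivisors' hΨne ?_ ?_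
    · intro n hn
      have hn' : n < M := by omega
      have hexp : Ψ = ∑ j ∈ range J, (f ^ M * (A j * 1 * X ^ (j * p)) +
          f ^ M * (B j * g * X ^ (j * p))) := by
        rw [hΨ, hΨ₀, mul_sum]
        exact sum_congr rfl fun j _ => by ring
      rw [IsRoot.def, hexp, iterate_derivative_sum, eval_finsetSum]
      have hz := congrArg (fun P => eval t (f ^ (M - n)) * eval t P) (hzero n hn')
      simp only [eval_zero, mul_zero, eval_finsetSum, mul_sum] at hz
      rw [← hz]
      refine sum_congr rfl fun j _ => ?_
      rw [iterate_map_add, iterate_derivative_pow_mul (e := 0) (by simp) (hXd j) M _ hn'.le,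
        iterate_derivative_pow_mul hgd (hXd j) M _ hn'.le]
      simp only [eval_add, eval_mul, eval_pow, eval_X, eval_C, eval_one, hgt]
      rw [mul_comm j p, pow_mul, ZMod.pow_card]
      ring
    · intro n hn hn0
      refine mem_nonZeroDivisors_of_ne_zero ?_
      rw [Ne, ZMod.natCast_eq_zero_iff]
      exact Nat.not_dvd_of_pos_of_lt (by omega) (by omega)
  refine (card_mul_le_natDegree Ψ _ M hroot).trans ?_
  have hdeg : ∀ {P : (ZMod p)[X]}, P ∈ degreeLT (ZMod p) a → P.natDegree ≤ a := fun hP =>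
    natDegree_le_of_degree_le (mem_degreeLT.mp hP).le
  have hgdeg : g.natDegree ≤ m * ((p - 1) / 2) := by
    rw [hg]; refine natDegree_pow_le.trans ?_
    rw [mul_comm]; exact Nat.mul_le_mul_right _ hf
  have h1 : Ψ₀.natDegree ≤ a + m * ((p - 1) / 2) + J * p := by
    refine natDegree_sum_le_of_forall_le _ _ fun j hj => ?_
    have hj' : j * p ≤ J * p := Nat.mul_le_mul_right _ (mem_range.mp hj).le
    refine natDegree_mul_le.trans ?_
    rw [natDegree_X_pow]
    have h2 : (A j + B j * g).natDegree ≤ a + m * ((p - 1) / 2) := by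
      refine natDegree_add_le_of_degree_le ((hdeg (hA j)).trans (by omega)) ?_
      exact natDegree_mul_le.trans (add_le_add (hdeg (hB j)) hgdeg)
    omega
  have h2 : (f ^ M).natDegree ≤ M * m := natDegree_pow_le.trans (Nat.mul_le_mul_left _ hf)
  exact natDegree_mul_le.trans (by omega)

end Stepanov

section CharacterSums

open Polynomial

variable {p : ℕ} [Fact p.Prime]

lemma stepanov_parameters {s m M a J : ℝ} (hm : 1 ≤ m) (hms : 40 * m ≤ s) (hM : M ≤ s)
    (hM0 : 0 ≤ M) (ha : s ^ 2 - m - 1 ≤ 2 * a) (hJ : M / 2 + 2 * m + 3 / 2 ≤ J) :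
    M * (a + M * m + J) < 2 * a * J := by
  have h1 : 9 / 10 * s ^ 2 ≤ 2 * a - M := by nlinarith
  have h2 : M ^ 2 ≤ s ^ 2 := by gcongr
  have h3 : (M / 2 + 2 * m + 3 / 2) * (2 * a - M) ≤ J * (2 * a - M) :=
    mul_le_mul_of_nonneg_right hJ (by nlinarith)
  have h4 : (2 * m + 3 / 2) * (9 / 10 * s ^ 2) ≤ (2 * m + 3 / 2) * (2 * a - M) := by gcongr
  have h5 : M ^ 2 * (m + 1 / 2) ≤ s ^ 2 * (m + 1 / 2) := by gcongr
  have h6 : 0 < s ^ 2 * m := by have : 0 < s := by linarith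
                                positivity
  nlinarith

lemma card_pow_eq_le (hp : p ≠ 2) {f : (ZMod p)[X]} {m : ℕ} (hm : 1 ≤ m)
    (hf : f.natDegree ≤ m) (hf0 : f.eval 0 ≠ 0) {r : ZMod p} (hr : f.rootMultiplicity r = 1)
    (ε : ZMod p) :
    (#{t : ZMod p | f.eval t ^ ((p - 1) / 2) = ε} : ℝ) ≤ p / 2 + 40 * m * √p := by
  set N := #{t : ZMod p | f.eval t ^ ((p - 1) / 2) = ε} with hN
  set s := √(p : ℝ) with hs
  have hs2 : s ^ 2 = p := Real.sq_sqrt (Nat.cast_nonneg _)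
  have hs0 : 0 ≤ s := Real.sqrt_nonneg _
  have hm' : (1 : ℝ) ≤ m := by exact_mod_cast hm
  rcases lt_or_ge s (40 * m) with hsm | hsm
  · have : (N : ℝ) ≤ p := by
      have : N ≤ p := (card_le_univ _).trans_eq (ZMod.card p)
      exact_mod_cast this
    nlinarith
  have hmp : m ≤ p := by
    have : (m : ℝ) ≤ p := by nlinarith
    exact_mod_cast this
  have hMs : (Nat.sqrt p : ℝ) ≤ s := Real.nat_sqrt_le_real_sqrt
  have hMs' : s < Nat.sqrt p + 1 := Real.real_sqrt_lt_nat_sqrt_succ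
  set M := Nat.sqrt p with hM
  have hMp : M ≤ p := Nat.sqrt_le_self p
  have ha1 : ((2 * ((p - m) / 2) + m : ℕ) : ℝ) ≤ p := by
    exact_mod_cast (by omega : 2 * ((p - m) / 2) + m ≤ p)
  have ha2 : (p : ℝ) ≤ ((2 * ((p - m) / 2) + m + 1 : ℕ) : ℝ) := by
    exact_mod_cast (by omega : p ≤ 2 * ((p - m) / 2) + m + 1)
  have hJ1 : (M : ℝ) ≤ ((2 * (M / 2) + 1 : ℕ) : ℝ) := by
    exact_mod_cast (by omega : M ≤ 2 * (M / 2) + 1)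
  have hJ2 : ((2 * (M / 2) : ℕ) : ℝ) ≤ M := by
    exact_mod_cast (by omega : 2 * (M / 2) ≤ M)
  have hq : ((2 * ((p - 1) / 2) : ℕ) : ℝ) ≤ p := by
    exact_mod_cast (by omega : 2 * ((p - 1) / 2) ≤ p)
  set a := (p - m) / 2 with ha
  set J := M / 2 + (2 * m + 2) with hJ
  push_cast at ha1 ha2 hJ1 hJ2 hq
  have hJr : (J : ℝ) = ((M / 2 : ℕ) : ℝ) + (2 * m + 2) := by rw [hJ]; push_cast; ring
  have hdim : M * (a + M * m + J) < 2 * a * J := by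
    have : (M : ℝ) * (a + M * m + J) < 2 * a * J :=
      stepanov_parameters hm' hsm hMs (Nat.cast_nonneg _) (by linarith) (by linarith)
    exact_mod_cast this
  have key := stepanov_bound hp hf hf0 hr ε hMp (by omega) hdim
  rw [← hN] at key
  have key' : (N : ℝ) * M ≤ M * m + a + m * ((p - 1) / 2 : ℕ) + J * p := by exact_mod_cast key
  have hM0 : (0 : ℝ) < M := by linarith
  refine le_of_mul_le_mul_right (key'.trans ?_) hM0
  have h1 : (m : ℝ) * ((p - 1) / 2 : ℕ) ≤ m * (p / 2) := by gcongr; linarith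
  have h2 : (J : ℝ) * p ≤ (M / 2 + 2 * m + 2) * p := by gcongr; linarith
  have h3 : (a : ℝ) ≤ p / 2 := by linarith
  have h4 : s / 2 ≤ M := by linarith
  have h5 : (m : ℝ) * s * (s / 2) ≤ m * s * M := by gcongr
  have h6 : (p : ℝ) * 1 ≤ p * m := by gcongr
  have h7 : (M : ℝ) * m ≤ p * m := by gcongr
  rw [← hs2] at *
  nlinarith

/-- The polynomial `∏ (X + i)` over a finite set of natural numbers. -/
noncomputable def shiftPoly (p : ℕ) (I : Finset ℕ) : (ZMod p)[X] :=
  ∏ i ∈ I, (X + C (i : ZMod p))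

lemma eval_shiftPoly (I : Finset ℕ) (t : ZMod p) :
    (shiftPoly p I).eval t = ∏ i ∈ I, (t + i) := by
  simp [shiftPoly, eval_prod]

lemma natDegree_shiftPoly_le (I : Finset ℕ) : (shiftPoly p I).natDegree ≤ #I := by
  refine (natDegree_prod_le _ _).trans ?_
  refine (sum_le_card_nsmul I _ 1 fun i _ => (natDegree_X_add_C _).le).trans ?_
  simp

lemma natCast_injOn_of_lt {k : ℕ} (hk : k < p) :
    Set.InjOn (fun i : ℕ => (i : ZMod p)) (Set.Icc 1 k) := by
  intro i hi j hj hij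
  have hi' := hi.2
  have hj' := hj.2
  have := (ZMod.natCast_eq_natCast_iff' i j p).mp hij
  rwa [Nat.mod_eq_of_lt (by omega), Nat.mod_eq_of_lt (by omega)] at this

lemma rootMultiplicity_shiftPoly {I : Finset ℕ} {k i : ℕ} (hk : k < p) (hI : I ⊆ Icc 1 k)
    (hi : i ∈ I) : (shiftPoly p I).rootMultiplicity (-(i : ZMod p)) = 1 := by
  have hne : shiftPoly p I ≠ 0 := prod_ne_zero_iff.mpr fun i _ => X_add_C_ne_zero _
  rw [shiftPoly, ← mul_prod_erase I _ hi] at hne ⊢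
  rw [rootMultiplicity_mul hne]
  have h1 : (X + C (i : ZMod p)) = X - C (-(i : ZMod p)) := by simp
  have h2 : rootMultiplicity (-(i : ZMod p)) (∏ j ∈ I.erase i, (X + C (j : ZMod p))) = 0 := by
    rw [rootMultiplicity_eq_zero_iff]
    intro hroot
    exfalso
    rw [IsRoot.def, eval_prod, prod_eq_zero_iff] at hroot
    obtain ⟨j, hj, hj0⟩ := hroot
    simp only [eval_add, eval_X, eval_C] at hj0
    have hij : (j : ZMod p) = i := by linear_combination hj0
    exact (ne_of_mem_erase hj) (natCast_injOn_of_lt hk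
      (by simpa using hI (mem_of_mem_erase hj)) (by simpa using hI hi) hij)
  rw [h2, h1, rootMultiplicity_X_sub_C_self]

lemma natCast_ne_zero_of_mem_Icc {k i : ℕ} (hk : k < p) (hi : i ∈ Icc 1 k) :
    (i : ZMod p) ≠ 0 := by
  rw [mem_Icc] at hi
  rw [Ne, ZMod.natCast_eq_zero_iff]
  exact Nat.not_dvd_of_pos_of_lt (by omega) (by omega)

lemma quadraticChar_eq_iff_pow (hp : p ≠ 2) (x : ZMod p) {ε : ℤ} (hε : ε = 1 ∨ ε = -1) :
    quadraticChar (ZMod p) x = ε ↔ x ^ ((p - 1) / 2) = (ε : ZMod p) := by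
  have hpp : p.Prime := Fact.out
  have hch : ringChar (ZMod p) ≠ 2 := by rwa [ZMod.ringChar_zmod_n]
  have h2 : p / 2 = (p - 1) / 2 := by
    have := hpp.eq_two_or_odd; omega
  have hpow := quadraticChar_eq_pow_of_char_ne_two' hch x
  rw [ZMod.card, h2] at hpow
  rw [← hpow]
  refine ⟨fun h => by rw [h], fun h => ?_⟩
  have h2' : (2 : ZMod p) ≠ 0 := Ring.two_ne_zero hch
  have key : (1 : ZMod p) ≠ -1 := fun h => h2' (by linear_combination h)
  rcases quadraticChar_isQuadratic (ZMod p) x with h0 | h0 | h0 <;> rcases hε with rfl | rfl <;>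
    simp_all [eq_comm]

theorem abs_sum_quadraticChar_shift_le (hp : p ≠ 2) {k : ℕ} (hk : k < p) {I : Finset ℕ}
    (hI : I ⊆ Icc 1 k) (hne : I.Nonempty) :
    |∑ t : ZMod p, (quadraticChar (ZMod p) (∏ i ∈ I, (t + (i : ZMod p))) : ℝ)| ≤
      81 * #I * √p := by
  set χ := quadraticChar (ZMod p)
  have hm : 1 ≤ #I := hne.card_pos
  obtain ⟨i₀, hi₀⟩ := hne
  have hf0 : (shiftPoly p I).eval 0 ≠ 0 := by
    rw [eval_shiftPoly]
    exact prod_ne_zero_iff.mpr fun i hi => by simpa using natCast_ne_zero_of_mem_Icc hk (hI hi)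
  have hbound : ∀ ε : ℤ, (ε = 1 ∨ ε = -1) →
      (#{t : ZMod p | χ (∏ i ∈ I, (t + (i : ZMod p))) = ε} : ℝ) ≤ p / 2 + 40 * #I * √p := by
    intro ε hε
    have := card_pow_eq_le hp hm (natDegree_shiftPoly_le I) hf0
      (rootMultiplicity_shiftPoly hk hI hi₀) (ε : ZMod p)
    simp only [eval_shiftPoly, ← quadraticChar_eq_iff_pow hp _ hε] at this
    exact this
  have hzero : #{t : ZMod p | χ (∏ i ∈ I, (t + (i : ZMod p))) = 0} ≤ #I := by
    refine (card_le_card (t := I.image fun i : ℕ => -(i : ZMod p)) fun t ht => ?_).trans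
      card_image_le
    simp only [mem_filter, mem_univ, true_and, χ, quadraticChar_eq_zero_iff,
      prod_eq_zero_iff] at ht
    obtain ⟨i, hi, h⟩ := ht
    exact mem_image.mpr ⟨i, hi, by linear_combination -h⟩
  have hcases : ∀ t : ZMod p,
      (χ t : ℝ) = (if χ t = 1 then 1 else 0) - (if χ t = -1 then 1 else 0) ∧
      (1 : ℝ) = (if χ t = 1 then 1 else 0) + (if χ t = -1 then 1 else 0) +
        (if χ t = 0 then 1 else 0) := by
    intro t
    rcases quadraticChar_isQuadratic (ZMod p) t with h0 | h0 | h0 <;> simp [χ, h0]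
  have hsum : ∑ t : ZMod p, (χ (∏ i ∈ I, (t + (i : ZMod p))) : ℝ) =
      #{t : ZMod p | χ (∏ i ∈ I, (t + (i : ZMod p))) = 1} -
      #{t : ZMod p | χ (∏ i ∈ I, (t + (i : ZMod p))) = -1} := by
    rw [sum_congr rfl fun t _ => (hcases _).1]
    simp [sum_sub_distrib]
  have htot : (p : ℝ) = #{t : ZMod p | χ (∏ i ∈ I, (t + (i : ZMod p))) = 1} +
      #{t : ZMod p | χ (∏ i ∈ I, (t + (i : ZMod p))) = -1} +
      #{t : ZMod p | χ (∏ i ∈ I, (t + (i : ZMod p))) = 0} := by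
    have h1 : (p : ℝ) = ∑ t : ZMod p, 1 := by simp [ZMod.card]
    rw [h1, sum_congr rfl fun t _ => (hcases (∏ i ∈ I, (t + (i : ZMod p)))).2]
    simp [sum_add_distrib]
  have b1 := hbound 1 (Or.inl rfl)
  have b2 := hbound (-1) (Or.inr rfl)
  have b0 : (#{t : ZMod p | χ (∏ i ∈ I, (t + (i : ZMod p))) = 0} : ℝ) ≤ #I * √p := by
    have h1 : (1 : ℝ) ≤ √p := Real.one_le_sqrt.mpr (by exact_mod_cast (Fact.out : p.Prime).one_le)
    calc _ ≤ (#I : ℝ) := by exact_mod_cast hzero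
      _ ≤ #I * √p := le_mul_of_one_le_right (Nat.cast_nonneg _) h1
  rw [hsum, abs_le]
  constructor <;> linarith

open Classical in
/-- The elements `y` such that the quadratic character takes the value `ε` at
`y + 1, …, y + k`. -/
noncomputable def constRun (p : ℕ) [Fact p.Prime] (k : ℕ) (ε : ℤ) : Finset (ZMod p) :=
  {y : ZMod p | ∀ i ∈ Icc 1 k, quadraticChar (ZMod p) (y + (i : ZMod p)) = ε}

lemma mem_constRun {k : ℕ} {ε : ℤ} {y : ZMod p} : y ∈ constRun p k ε ↔
    ∀ i ∈ Icc 1 k, quadraticChar (ZMod p) (y + (i : ZMod p)) = ε := by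
  simp [constRun]

theorem card_constRun_mul_le (hp : p ≠ 2) {k : ℕ} (hk : k < p) {ε : ℤ} (hε : ε = 1 ∨ ε = -1) :
    (#(constRun p k ε) : ℝ) * 2 ^ k ≤ p + 2 ^ k * (81 * k * √p) := by
  set χ := quadraticChar (ZMod p)
  have hε2 : (ε : ℝ) * ε = 1 := by rcases hε with rfl | rfl <;> norm_num
  have hε1 : |(ε : ℝ)| = 1 := by rcases hε with rfl | rfl <;> norm_num
  have hnonneg : ∀ y : ZMod p, (0 : ℝ) ≤ 1 + ε * χ y := by
    intro y
    rcases quadraticChar_isQuadratic (ZMod p) y with h | h | h <;> rcases hε with rfl | rfl <;>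
      simp [χ, h]
  calc (#(constRun p k ε) : ℝ) * 2 ^ k
      = ∑ y ∈ constRun p k ε, ∏ i ∈ Icc 1 k, (1 + ε * χ (y + (i : ZMod p)) : ℝ) := by
        rw [← nsmul_eq_mul, ← sum_const]
        refine sum_congr rfl fun y hy => ?_
        rw [prod_congr rfl fun i hi => by rw [mem_constRun.mp hy i hi, hε2]]
        norm_num
    _ ≤ ∑ y : ZMod p, ∏ i ∈ Icc 1 k, (1 + ε * χ (y + (i : ZMod p)) : ℝ) :=
        sum_le_sum_of_subset_of_nonneg (subset_univ _) fun y _ _ =>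
          prod_nonneg fun i _ => hnonneg _
    _ = ∑ I ∈ (Icc 1 k).powerset, (ε : ℝ) ^ #I *
          ∑ y : ZMod p, (χ (∏ i ∈ I, (y + (i : ZMod p))) : ℝ) := by
        simp_rw [prod_one_add, prod_mul_distrib, prod_const]
        rw [sum_comm]
        refine sum_congr rfl fun I _ => ?_
        rw [mul_sum]
        refine sum_congr rfl fun y _ => ?_
        rw [map_prod]; push_cast; rfl
    _ ≤ ∑ I ∈ (Icc 1 k).powerset, ((if I = ∅ then (p : ℝ) else 0) + 81 * k * √p) := by
        refine sum_le_sum fun I hI => ?_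
        rw [mem_powerset] at hI
        rcases I.eq_empty_or_nonempty with rfl | hne
        · simp only [card_empty, pow_zero, prod_empty, map_one, if_true]
          simp only [Int.cast_one, sum_const, card_univ, ZMod.card, nsmul_eq_mul, mul_one, one_mul]
          have : (0 : ℝ) ≤ 81 * k * √p := by positivity
          linarith
        · rw [if_neg hne.ne_empty, zero_add]
          refine (le_abs_self _).trans ?_
          rw [abs_mul, abs_pow, hε1, one_pow, one_mul]
          refine (abs_sum_quadraticChar_shift_le hp hk hI hne).trans ?_
          have : #I ≤ k := by simpa using card_le_card hI
          gcongr
    _ = p + 2 ^ k * (81 * k * √p) := by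
        rw [sum_add_distrib, sum_ite_eq' ]
        simp

theorem card_constRun_log_le (hp : p ≠ 2) {ε : ℤ} (hε : ε = 1 ∨ ε = -1) :
    (#(constRun p (Nat.log 2 p) ε) : ℝ) ≤ 83 * Nat.log 2 p * √p := by
  have hpp : p.Prime := Fact.out
  set k := Nat.log 2 p with hk
  have hkp : k < p := Nat.log_lt_self 2 hpp.ne_zero
  have hk1 : 1 ≤ k := Nat.log_pos one_lt_two hpp.two_le
  have h1 := card_constRun_mul_le hp hkp hε
  have h2 : (p : ℝ) ≤ 2 ^ k * 2 := by
    rw [← pow_succ]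
    exact_mod_cast (Nat.lt_pow_succ_log_self one_lt_two p).le
  have h3 : (1 : ℝ) ≤ √p := Real.one_le_sqrt.mpr (by exact_mod_cast hpp.one_le)
  have hk1' : (1 : ℝ) ≤ k := by exact_mod_cast hk1
  have h4 : (1 : ℝ) ≤ k * √p := by nlinarith
  have h5 : (0 : ℝ) < 2 ^ k := by positivity
  refine le_of_mul_le_mul_right (h1.trans ?_) h5
  nlinarith

end CharacterSums

section Fourier

open ZMod (stdAddChar)

variable {p : ℕ} [Fact p.Prime]

lemma sum_norm_sq_trigPoly {ι : Type*} (s : Finset ι) {φ : ι → ZMod p} (hφ : Set.InjOn φ s)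
    (G : ι → ℂ) :
    ∑ y : ZMod p, ‖∑ i ∈ s, G i * stdAddChar (φ i * y)‖ ^ 2 = p * ∑ i ∈ s, ‖G i‖ ^ 2 := by
  classical
  apply Complex.ofReal_injective
  push_cast
  have hterm : ∀ y : ZMod p, (‖∑ i ∈ s, G i * stdAddChar (φ i * y)‖ : ℂ) ^ 2 =
      ∑ i ∈ s, ∑ j ∈ s, G i * (starRingEnd ℂ) (G j) * stdAddChar (y * (φ i - φ j)) := by
    intro y
    rw [← Complex.mul_conj', map_sum, sum_mul_sum]
    refine sum_congr rfl fun i _ => sum_congr rfl fun j _ => ?_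
    rw [map_mul (starRingEnd ℂ), ← AddChar.map_neg_eq_conj, mul_mul_mul_comm, ← AddChar.map_add_eq_mul]
    congr 2
    ring
  simp_rw [hterm]
  rw [sum_comm, mul_sum]
  refine sum_congr rfl fun i hi => ?_
  rw [sum_comm]
  simp_rw [← mul_sum, AddChar.sum_mulShift _ (ZMod.isPrimitive_stdAddChar p)]
  rw [sum_eq_single_of_mem i hi]
  · rw [sub_self, if_pos rfl, ZMod.card, Complex.mul_conj']; ring
  · intro j hj hji
    rw [if_neg, Nat.cast_zero, mul_zero]
    exact fun h => hji (hφ hj hi (sub_eq_zero.mp h).symm)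

/-- The (unnormalised) Fejér kernel of degree `D` on `ZMod p`. -/
noncomputable def fejer (p : ℕ) [Fact p.Prime] (D : ℕ) (v : ZMod p) : ℝ :=
  ‖∑ a ∈ range D, stdAddChar ((a : ZMod p) * v)‖ ^ 2

lemma fejer_nonneg (D : ℕ) (v : ZMod p) : 0 ≤ fejer p D v := sq_nonneg _

lemma natCast_injOn_range {D : ℕ} (hD : D ≤ p) :
    Set.InjOn (fun a : ℕ => (a : ZMod p)) (range D) := by
  intro i hi j hj hij
  rw [mem_coe, mem_range] at hi hj
  have := (ZMod.natCast_eq_natCast_iff' i j p).mp hij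
  rwa [Nat.mod_eq_of_lt (by omega), Nat.mod_eq_of_lt (by omega)] at this

lemma sum_fejer {D : ℕ} (hD : D ≤ p) : ∑ v : ZMod p, fejer p D v = p * D := by
  have := sum_norm_sq_trigPoly (range D) (natCast_injOn_range hD) (fun _ => 1)
  simpa [fejer] using this

lemma fejer_neg (D : ℕ) (v : ZMod p) : fejer p D (-v) = fejer p D v := by
  unfold fejer
  have : ∑ a ∈ range D, stdAddChar ((a : ZMod p) * -v) =
      (starRingEnd ℂ) (∑ a ∈ range D, stdAddChar ((a : ZMod p) * v)) := by
    rw [map_sum]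
    refine sum_congr rfl fun a _ => ?_
    rw [← AddChar.map_neg_eq_conj, mul_neg]
  rw [this, RCLike.norm_conj]

lemma fejer_natCast_le (D : ℕ) {n : ℕ} (hn : 1 ≤ n) (hnp : 2 * n ≤ p) :
    fejer p D n ≤ (p : ℝ) ^ 2 / 4 * ((n : ℝ) ^ 2)⁻¹ := by
  have hp0 : (0 : ℝ) < p := by exact_mod_cast (Fact.out : p.Prime).pos
  have hn0 : (0 : ℝ) < n := by exact_mod_cast hn
  set z : ℂ := stdAddChar (n : ZMod p) with hz
  have hgeom : (1 - z) * ∑ a ∈ range D, stdAddChar ((a : ZMod p) * (n : ZMod p)) = 1 - z ^ D := by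
    rw [← mul_neg_geom_sum]
    congr 1
    refine sum_congr rfl fun a _ => ?_
    rw [hz, ← AddChar.map_nsmul_eq_pow, nsmul_eq_mul]
  have hz1 : ‖z‖ = 1 := AddChar.norm_apply _ _
  have hup : ‖1 - z ^ D‖ ≤ 2 := by
    refine (norm_sub_le _ _).trans ?_
    rw [norm_pow, hz1]; norm_num
  have hlow : 4 * n / p ≤ ‖1 - z‖ := by
    have hze : z = Complex.exp (Complex.I * ((2 * Real.pi * n / p : ℝ) : ℂ)) := by
      have h := ZMod.stdAddChar_coe (N := p) (n : ℤ)
      push_cast at h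
      rw [hz, h]
      congr 1
      push_cast
      ring
    rw [norm_sub_rev, hze, Complex.norm_exp_I_mul_ofReal_sub_one]
    have hle : (2 * n : ℝ) ≤ p := by exact_mod_cast hnp
    have hpi := Real.pi_pos
    have hs := Real.mul_le_sin (x := 2 * Real.pi * n / p / 2) (by positivity) (by
      rw [div_div, div_le_div_iff₀ (by positivity) (by positivity)]
      nlinarith)
    have he : 2 / Real.pi * (2 * Real.pi * n / p / 2) = 2 * n / p := by
      field_simp
    rw [he] at hs
    refine le_trans ?_ (Real.le_norm_self _)
    calc (4 * n / p : ℝ) = 2 * (2 * n / p) := by ring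
      _ ≤ _ := by gcongr
  have hprod : 4 * n / p * ‖∑ a ∈ range D, stdAddChar ((a : ZMod p) * (n : ZMod p))‖ ≤ 2 := by
    calc _ ≤ ‖1 - z‖ * ‖∑ a ∈ range D, stdAddChar ((a : ZMod p) * (n : ZMod p))‖ := by gcongr
      _ ≤ 2 := by rw [← norm_mul, hgeom]; exact hup
  have hF : ‖∑ a ∈ range D, stdAddChar ((a : ZMod p) * (n : ZMod p))‖ ≤ p / (2 * n) := by
    rw [le_div_iff₀ (by positivity)]
    rw [div_mul_eq_mul_div, div_le_iff₀ hp0] at hprod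
    linarith
  calc fejer p D n ≤ (p / (2 * n)) ^ 2 := by unfold fejer; gcongr
    _ = (p : ℝ) ^ 2 / 4 * ((n : ℝ) ^ 2)⁻¹ := by field_simp; norm_num

lemma sum_fejer_tail_le (D : ℕ) {H : ℕ} (hH : 1 ≤ H) (B : Finset (ZMod p))
    (hB : ∀ v ∈ B, ∀ j ≤ 2 * H, v ≠ (j : ZMod p) - H) :
    ∑ v ∈ B, fejer p D v ≤ (p : ℝ) ^ 2 / (2 * H) := by
  have hH0 : (0 : ℝ) < H := by exact_mod_cast hH
  set U := Ioc H (p / 2)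
  have hsub : B ⊆ U.image (fun n : ℕ => (n : ZMod p)) ∪ U.image (fun n : ℕ => -(n : ZMod p)) := by
    intro v hv
    have hval : ((v.val : ℕ) : ZMod p) = v := ZMod.natCast_zmod_val v
    have hlt : v.val < p := ZMod.val_lt v
    rw [mem_union, mem_image, mem_image]
    rcases le_or_gt v.val (p / 2) with h | h
    · refine Or.inl ⟨v.val, mem_Ioc.mpr ⟨?_, h⟩, hval⟩
      by_contra! hc
      refine hB v hv (v.val + H) (by omega) ?_
      push_cast
      rw [hval]; ring
    · have hcast : ((p - v.val : ℕ) : ZMod p) = -v := by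
        rw [Nat.cast_sub hlt.le, hval]; simp
      refine Or.inr ⟨p - v.val, mem_Ioc.mpr ⟨?_, by omega⟩, by rw [hcast, neg_neg]⟩
      by_contra! hc
      refine hB v hv (H - (p - v.val)) (by omega) ?_
      rw [Nat.cast_sub hc, hcast]; ring
  have hK : ∀ n ∈ U, fejer p D n ≤ (p : ℝ) ^ 2 / 4 * ((n : ℝ) ^ 2)⁻¹ := fun n hn => by
    rw [mem_Ioc] at hn
    exact fejer_natCast_le D (by omega) (by omega)
  have hU : ∑ n ∈ U, ((n : ℝ) ^ 2)⁻¹ ≤ (H : ℝ)⁻¹ := by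
    rcases le_or_gt H (p / 2) with h | h
    · refine (sum_Ioc_inv_sq_le_sub (by omega) h).trans ?_
      simp
    · rw [show U = ∅ from Ioc_eq_empty_of_le h.le]; simp
  have hsumU : ∑ n ∈ U, fejer p D n ≤ (p : ℝ) ^ 2 / 4 * (H : ℝ)⁻¹ :=
    (sum_le_sum hK).trans (by rw [← mul_sum]; gcongr)
  calc ∑ v ∈ B, fejer p D v
      ≤ ∑ v ∈ U.image (fun n : ℕ => (n : ZMod p)) ∪ U.image (fun n : ℕ => -(n : ZMod p)),
          fejer p D v :=
        sum_le_sum_of_subset_of_nonneg hsub fun v _ _ => fejer_nonneg D v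
    _ ≤ ∑ v ∈ U.image (fun n : ℕ => (n : ZMod p)), fejer p D v +
          ∑ v ∈ U.image (fun n : ℕ => -(n : ZMod p)), fejer p D v := by
        rw [← sum_union_inter]
        exact le_add_of_nonneg_right (sum_nonneg fun v _ => fejer_nonneg D v)
    _ ≤ ∑ n ∈ U, fejer p D n + ∑ n ∈ U, fejer p D (-(n : ZMod p)) :=
        add_le_add (sum_image_le_of_nonneg fun v _ => fejer_nonneg D v)
          (sum_image_le_of_nonneg fun v _ => fejer_nonneg D v)
    _ ≤ (p : ℝ) ^ 2 / 4 * (H : ℝ)⁻¹ + (p : ℝ) ^ 2 / 4 * (H : ℝ)⁻¹ := by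
        simp only [fejer_neg]
        exact add_le_add hsumU hsumU
    _ = (p : ℝ) ^ 2 / (2 * H) := by field_simp; ring

lemma fejer_eq_sum (D : ℕ) (v : ZMod p) : (fejer p D v : ℂ) =
    ∑ ab ∈ range D ×ˢ range D, stdAddChar (((ab.1 : ZMod p) - (ab.2 : ZMod p)) * v) := by
  rw [fejer]
  push_cast
  rw [← Complex.mul_conj', map_sum, sum_mul_sum, sum_product]
  refine sum_congr rfl fun a _ => sum_congr rfl fun b _ => ?_
  rw [← AddChar.map_neg_eq_conj, ← AddChar.map_add_eq_mul]
  congr 1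
  ring

lemma card_prime_dvd_le {P : Finset ℕ} (hP : ∀ q ∈ P, q.Prime) {n N : ℕ} (hn : n ≠ 0)
    (hN : n ≤ N) : #{q ∈ P | q ∣ n} ≤ Nat.log 2 N := by
  have h1 : #{q ∈ P | q ∣ n} ≤ #n.primeFactors := card_le_card fun q hq => by
    rw [mem_filter] at hq
    exact Nat.mem_primeFactors.mpr ⟨hP q hq.1, hq.2, hn⟩
  refine h1.trans (Nat.le_log_of_pow_le one_lt_two ?_)
  calc 2 ^ #n.primeFactors ≤ ∏ q ∈ n.primeFactors, q :=
        pow_card_le_prod _ _ _ fun q hq => (Nat.prime_of_mem_primeFactors hq).two_le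
    _ ≤ n := Nat.le_of_dvd (Nat.pos_of_ne_zero hn) (Nat.prod_primeFactors_dvd n)
    _ ≤ N := hN

/-- The sum of the dilates by `q ∈ P` of the convolution of the indicator function of a set `S`,
translated by `H`, with the Fejér kernel. -/
noncomputable def dilateSum (D H : ℕ) (P : Finset ℕ) (S : Finset (ZMod p)) (y : ZMod p) : ℝ :=
  ∑ q ∈ P, ∑ x ∈ S, fejer p D ((q : ZMod p) * y - x - H)

lemma sum_norm_sq_translate (S : Finset (ZMod p)) (c : ZMod p) :
    ∑ t : ZMod p, ‖∑ x ∈ S, stdAddChar (-(x + c) * t)‖ ^ 2 = p * #S := by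
  have := sum_norm_sq_trigPoly S (φ := fun x => -(x + c))
    (fun x _ y _ h => by simpa using h) (fun _ => 1)
  simpa using this

lemma sum_dilateSum_sq_le {D Q : ℕ} (H : ℕ) {P : Finset ℕ} (hP : ∀ q ∈ P, q.Prime)
    (hPQ : ∀ q ∈ P, q ≤ Q) (hDp : D ≤ p) (hDQ : 2 * (D * Q) ≤ p) (S : Finset (ZMod p)) :
    ∑ y : ZMod p, dilateSum D H P S y ^ 2 ≤
      p * ((#P * D * #S : ℝ) ^ 2 + Nat.log 2 p * D ^ 2 * #P * p * #S) := by
  set hatS : ZMod p → ℂ := fun t => ∑ x ∈ S, stdAddChar (-(x + (H : ZMod p)) * t) with hhat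
  set Ω := P ×ˢ (range D ×ˢ range D) with hΩ
  set η : ℕ × ℕ × ℕ → ℤ := fun ω => ((ω.2.1 : ℤ) - ω.2.2) * ω.1 with hη
  set E := Ω.image η with hE
  set G : ℤ → ℂ := fun n =>
    ∑ ω ∈ Ω with η ω = n, hatS ((ω.2.1 : ZMod p) - (ω.2.2 : ZMod p)) with hG
  have hηlt : ∀ ω ∈ Ω, 2 * |η ω| < p := by
    intro ω hω
    simp only [hΩ, mem_product, mem_range] at hω
    obtain ⟨hq, ha, hb⟩ := hω
    have hq1 : (0 : ℤ) < ω.1 := by exact_mod_cast (hP _ hq).pos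
    have hqQ : (ω.1 : ℤ) ≤ Q := by exact_mod_cast hPQ _ hq
    have hab : |(ω.2.1 : ℤ) - ω.2.2| < D := by rw [abs_lt]; constructor <;> omega
    have hDQ' : 2 * ((D : ℤ) * Q) ≤ p := by exact_mod_cast hDQ
    have h1 : |η ω| = |(ω.2.1 : ℤ) - ω.2.2| * ω.1 := by
      rw [hη]; simp only [abs_mul, Nat.abs_cast]
    have h2 : |(ω.2.1 : ℤ) - ω.2.2| * ω.1 < D * ω.1 := mul_lt_mul_of_pos_right hab hq1
    have h3 : (D : ℤ) * ω.1 ≤ D * Q := by gcongr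
    omega
  have hinj : Set.InjOn (fun n : ℤ => (n : ZMod p)) E := by
    intro m hm n hn hmn
    simp only [hE, coe_image, Set.mem_image, mem_coe] at hm hn
    obtain ⟨ω, hω, rfl⟩ := hm
    obtain ⟨ω', hω', rfl⟩ := hn
    have h1 := hηlt ω hω
    have h2 := hηlt ω' hω'
    have hdvd := (ZMod.intCast_eq_intCast_iff_dvd_sub _ _ _).mp hmn
    have h0 : η ω' - η ω = 0 := by
      refine Int.eq_zero_of_abs_lt_dvd hdvd ?_
      have := abs_sub (η ω') (η ω)
      omega
    omega
  have hexpand : ∀ y : ZMod p, ((dilateSum D H P S y : ℝ) : ℂ) =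
      ∑ n ∈ E, G n * stdAddChar ((n : ZMod p) * y) := by
    intro y
    calc ((dilateSum D H P S y : ℝ) : ℂ)
        = ∑ ω ∈ Ω,
            hatS ((ω.2.1 : ZMod p) - (ω.2.2 : ZMod p)) * stdAddChar ((η ω : ZMod p) * y) := by
          rw [dilateSum, hΩ, sum_product]
          push_cast
          refine sum_congr rfl fun q _ => ?_
          simp_rw [fejer_eq_sum]
          rw [sum_comm]
          refine sum_congr rfl fun ab _ => ?_
          rw [hhat, sum_mul]
          refine sum_congr rfl fun x _ => ?_
          rw [← AddChar.map_add_eq_mul]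
          congr 1
          simp only [hη]
          push_cast
          ring
      _ = ∑ n ∈ E, ∑ ω ∈ Ω with η ω = n,
            hatS ((ω.2.1 : ZMod p) - (ω.2.2 : ZMod p)) * stdAddChar ((η ω : ZMod p) * y) :=
          (sum_fiberwise_of_maps_to (fun ω hω => mem_image_of_mem η hω) _).symm
      _ = ∑ n ∈ E, G n * stdAddChar ((n : ZMod p) * y) := by
          refine sum_congr rfl fun n _ => ?_
          rw [hG, sum_mul]
          refine sum_congr rfl fun ω hω => ?_
          rw [(mem_filter.mp hω).2]
  have hpars : ∑ y : ZMod p, dilateSum D H P S y ^ 2 = p * ∑ n ∈ E, ‖G n‖ ^ 2 := by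
    rw [← sum_norm_sq_trigPoly E hinj G]
    refine sum_congr rfl fun y _ => ?_
    rw [← hexpand, Complex.norm_real, Real.norm_eq_abs, sq_abs]
  have hcard : ∀ n ∈ E, n ≠ 0 → #{ω ∈ Ω | η ω = n} ≤ Nat.log 2 p * D := by
    intro n hn hn0
    obtain ⟨ω₀, hω₀, rfl⟩ := mem_image.mp hn
    have hlt := hηlt ω₀ hω₀
    have h1 : #{ω ∈ Ω | η ω = η ω₀} ≤ #({q ∈ P | q ∣ (η ω₀).natAbs} ×ˢ range D) := by
      refine card_le_card_of_injOn (fun ω => (ω.1, ω.2.1)) ?_ ?_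
      · intro ω hω
        simp only [coe_filter, Set.mem_ofPred_eq, hΩ, mem_product, mem_range] at hω
        simp only [mem_coe, mem_product, mem_filter, mem_range]
        refine ⟨⟨hω.1.1, ?_⟩, hω.1.2.1⟩
        rw [← hω.2, ← Int.natCast_dvd]
        exact Dvd.intro_left _ rfl
      · rintro ⟨q, a, b⟩ hω ⟨q', a', b'⟩ hω' heq
        simp only [coe_filter, Set.mem_ofPred_eq, hΩ, mem_product, mem_range] at hω hω'
        simp only [Prod.mk.injEq] at heq
        obtain ⟨rfl, rfl⟩ := heq
        have h2 := hω.2.trans hω'.2.symm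
        simp only [hη] at h2
        have hq0 : (q : ℤ) ≠ 0 := by exact_mod_cast (hP q hω.1.1).ne_zero
        have h3 := mul_right_cancel₀ hq0 h2
        have : b = b' := by omega
        rw [this]
    refine h1.trans ?_
    rw [card_product, card_range]
    refine Nat.mul_le_mul_right _ (card_prime_dvd_le hP (Int.natAbs_ne_zero.mpr hn0) ?_)
    rw [Int.abs_eq_natAbs] at hlt
    omega
  have hzero : ‖G 0‖ ^ 2 ≤ (#P * D * #S : ℝ) ^ 2 := by
    gcongr
    have hterm : ∀ ω ∈ Ω.filter (fun ω => η ω = 0),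
        ‖hatS ((ω.2.1 : ZMod p) - (ω.2.2 : ZMod p))‖ ≤ #S := by
      intro ω _
      refine (norm_sum_le _ _).trans ?_
      simp [AddChar.norm_apply]
    refine (norm_sum_le_of_le _ hterm).trans ?_
    rw [sum_const, nsmul_eq_mul]
    gcongr
    have : #{ω ∈ Ω | η ω = 0} ≤ #(P ×ˢ range D) := by
      refine card_le_card_of_injOn (fun ω => (ω.1, ω.2.1)) ?_ ?_
      · intro ω hω
        simp only [coe_filter, Set.mem_ofPred_eq, hΩ, mem_product] at hω
        simp only [mem_coe, mem_product]
        exact ⟨hω.1.1, hω.1.2.1⟩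
      · rintro ⟨q, a, b⟩ hω ⟨q', a', b'⟩ hω' heq
        simp only [coe_filter, Set.mem_ofPred_eq, hΩ, mem_product, mem_range] at hω hω'
        simp only [Prod.mk.injEq] at heq
        obtain ⟨rfl, rfl⟩ := heq
        have h2 := hω.2.trans hω'.2.symm
        simp only [hη] at h2
        have hq0 : (q : ℤ) ≠ 0 := by exact_mod_cast (hP q hω.1.1).ne_zero
        have h3 := mul_right_cancel₀ hq0 h2
        have : b = b' := by omega
        rw [this]
    rw [card_product, card_range] at this
    exact_mod_cast this
  have hhatsum : ∑ ω ∈ Ω, ‖hatS ((ω.2.1 : ZMod p) - (ω.2.2 : ZMod p))‖ ^ 2 ≤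
      #P * (D * (p * #S)) := by
    rw [hΩ, sum_product]
    dsimp only
    rw [sum_const, nsmul_eq_mul]
    gcongr
    rw [sum_product]
    calc ∑ a ∈ range D, ∑ b ∈ range D, ‖hatS ((a : ZMod p) - b)‖ ^ 2
        ≤ ∑ a ∈ range D, (p * #S : ℝ) := by
          refine sum_le_sum fun a _ => ?_
          rw [← sum_norm_sq_translate S (H : ZMod p)]
          rw [← sum_image (f := fun t => ‖hatS t‖ ^ 2) (g := fun b : ℕ => (a : ZMod p) - b)]
          · exact sum_le_sum_of_subset_of_nonneg (subset_univ _) fun _ _ _ => sq_nonneg _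
          · intro b hb b' hb' h
            exact natCast_injOn_range hDp hb hb' (sub_right_injective h)
      _ = D * (p * #S) := by simp
  have hoff : ∀ n ∈ E, ‖G n‖ ^ 2 ≤ (if n = 0 then (#P * D * #S : ℝ) ^ 2 else 0) +
      (Nat.log 2 p * D : ℝ) *
        ∑ ω ∈ Ω with η ω = n, ‖hatS ((ω.2.1 : ZMod p) - (ω.2.2 : ZMod p))‖ ^ 2 := by
    intro n hn
    by_cases hn0 : n = 0
    · rw [if_pos hn0, hn0]
      exact hzero.trans (le_add_of_nonneg_right (by positivity))
    · rw [if_neg hn0, zero_add]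
      calc ‖G n‖ ^ 2
          ≤ (∑ ω ∈ Ω with η ω = n, ‖hatS ((ω.2.1 : ZMod p) - (ω.2.2 : ZMod p))‖) ^ 2 := by
            gcongr; exact norm_sum_le _ _
        _ ≤ (#{ω ∈ Ω | η ω = n} : ℝ) *
              ∑ ω ∈ Ω with η ω = n, ‖hatS ((ω.2.1 : ZMod p) - (ω.2.2 : ZMod p))‖ ^ 2 :=
            sq_sum_le_card_mul_sum_sq
        _ ≤ _ := by
            gcongr
            exact_mod_cast hcard n hn hn0
  rw [hpars]
  gcongr
  calc ∑ n ∈ E, ‖G n‖ ^ 2 ≤ _ := sum_le_sum hoff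
    _ ≤ (#P * D * #S : ℝ) ^ 2 + (Nat.log 2 p * D : ℝ) * (#P * (D * (p * #S))) := by
        rw [sum_add_distrib, ← mul_sum,
          sum_fiberwise_of_maps_to (fun ω hω => mem_image_of_mem η hω)]
        gcongr
        rw [sum_ite_eq']
        split_ifs
        · exact le_rfl
        · positivity
    _ = _ := by ring

theorem card_mul_card_le_of_dilates_subset {Q : ℕ} (hQ : 1 ≤ Q) (hQp : 4 * Q ≤ p)
    {P : Finset ℕ} (hP : ∀ q ∈ P, q.Prime) (hPQ : ∀ q ∈ P, q ≤ Q) (S T : Finset (ZMod p))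
    (hST : ∀ x ∈ S, ∀ q ∈ P, ∀ j ≤ 8 * Q, ∀ y : ZMod p, (q : ZMod p) * y = x + j → y ∈ T) :
    (#P * #S : ℝ) ≤ 4 * #T * (#P * #S / p + Nat.log 2 p) := by
  have hp0 : (0 : ℝ) < p := by exact_mod_cast (Fact.out : p.Prime).pos
  set H := 4 * Q with hH
  set D := p / (2 * Q) with hD
  have hDp : D ≤ p := Nat.div_le_self _ _
  have hDQ : 2 * (D * Q) ≤ p := by
    have := Nat.div_mul_le_self p (2 * Q)
    rw [← hD] at this
    linarith
  have hDpos : 2 ≤ D := (Nat.le_div_iff_mul_le (by omega)).mpr (by linarith)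
  have hDH : p ≤ D * H := by
    have h1 := Nat.lt_div_mul_add (a := p) (b := 2 * Q) (by omega)
    rw [← hD] at h1
    rw [hH]
    nlinarith
  have hD0 : (0 : ℝ) < D := by exact_mod_cast (by omega : 0 < D)
  have hlower : ∀ q ∈ P, ∀ x ∈ S,
      (p * D / 2 : ℝ) ≤ ∑ y ∈ T, fejer p D ((q : ZMod p) * y - x - H) := by
    intro q hq x hx
    have hq0 : (q : ZMod p) ≠ 0 := by
      rw [Ne, ZMod.natCast_eq_zero_iff]
      have := hPQ q hq
      exact Nat.not_dvd_of_pos_of_lt (hP q hq).pos (by omega)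
    have hbij : Function.Bijective fun y : ZMod p => (q : ZMod p) * y - x - H := by
      rw [← Finite.injective_iff_bijective]
      intro y y' h
      simpa [hq0] using h
    have htot : ∑ y : ZMod p, fejer p D ((q : ZMod p) * y - x - H) = p * D := by
      rw [hbij.sum_comp (fejer p D), sum_fejer hDp]
    have htail : ∑ y ∈ Tᶜ, fejer p D ((q : ZMod p) * y - x - H) ≤ (p : ℝ) ^ 2 / (2 * H) := by
      rw [← sum_image (f := fejer p D) (g := fun y : ZMod p => (q : ZMod p) * y - x - H)
        hbij.injective.injOn]
      refine sum_fejer_tail_le D (by omega) _ ?_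
      intro v hv j hj hvj
      obtain ⟨y, hy, rfl⟩ := mem_image.mp hv
      refine (mem_compl.mp hy) (hST x hx q hq j (by omega) y ?_)
      linear_combination hvj
    have hb : (p : ℝ) ^ 2 / (2 * H) ≤ p * D / 2 := by
      have hDH' : (p : ℝ) ≤ D * H := by exact_mod_cast hDH
      have hH0 : (0 : ℝ) < H := by exact_mod_cast (by omega : 0 < H)
      rw [div_le_div_iff₀ (by positivity) (by positivity)]
      nlinarith
    rw [← sum_add_sum_compl T] at htot
    linarith
  have hlow : (#P * #S * (p * D / 2) : ℝ) ≤ ∑ y ∈ T, dilateSum D H P S y := by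
    unfold dilateSum
    rw [sum_comm]
    calc (#P * #S * (p * D / 2) : ℝ) = ∑ q ∈ P, ∑ x ∈ S, (p * D / 2 : ℝ) := by simp; ring
      _ ≤ _ := by
        refine sum_le_sum fun q hq => ?_
        rw [sum_comm]
        exact sum_le_sum fun x hx => hlower q hq x hx
  have hupp := sum_dilateSum_sq_le H hP hPQ hDp hDQ S
  set a : ℝ := #P * #S with ha
  have ha0 : 0 ≤ a := by positivity
  have hcs : (a * (p * D / 2)) ^ 2 ≤
      #T * (p * ((#P * D * #S : ℝ) ^ 2 + Nat.log 2 p * D ^ 2 * #P * p * #S)) := by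
    calc (a * (p * D / 2)) ^ 2 ≤ (∑ y ∈ T, dilateSum D H P S y) ^ 2 := by gcongr
      _ ≤ #T * ∑ y ∈ T, dilateSum D H P S y ^ 2 := sq_sum_le_card_mul_sum_sq
      _ ≤ #T * ∑ y : ZMod p, dilateSum D H P S y ^ 2 := by
          gcongr
          exact subset_univ _
      _ ≤ _ := by gcongr
  rcases ha0.eq_or_lt with h0 | h0
  · rw [← h0]; positivity
  have hfac : (0 : ℝ) < a * (p * D) ^ 2 / 4 := by positivity
  refine le_of_mul_le_mul_right (a := a * (p * D) ^ 2 / 4) ?_ hfac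
  calc a * (a * (p * D) ^ 2 / 4) = (a * (p * D / 2)) ^ 2 := by ring
    _ ≤ _ := hcs
    _ = 4 * #T * (a / p + Nat.log 2 p) * (a * (p * D) ^ 2 / 4) := by
        rw [ha]; field_simp

end Fourier

section Main

variable {p : ℕ} [Fact p.Prime]

lemma quadraticChar_add_natCast_of_mem_RplusSeg {h j : ℕ} {x : ZMod p} (hx : x ∈ RplusSeg p h)
    (hj : j ≤ h) : quadraticChar (ZMod p) (x + j) = 1 := by
  have hmem : x + (j : ZMod p) ∈ quadRes p := by
    rw [RplusSeg, mem_filter] at hx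
    rcases Nat.eq_zero_or_pos j with rfl | hj0
    · simpa using hx.1
    · exact hx.2 j (mem_Icc.mpr ⟨hj0, hj⟩)
  rw [quadRes, mem_filter] at hmem
  obtain ⟨-, y, hy, hyx⟩ := hmem
  rw [← hyx, quadraticChar_sq_one' hy]

lemma RplusSeg_eq_empty_of_le {h : ℕ} (hp : p ≤ h) : RplusSeg p h = ∅ := by
  refine eq_empty_of_forall_notMem fun x hx => ?_
  have h0 := quadraticChar_add_natCast_of_mem_RplusSeg hx ((Nat.sub_le p x.val).trans hp)
  rw [Nat.cast_sub (ZMod.val_lt x).le, ZMod.natCast_zmod_val] at h0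
  simp at h0

lemma RplusSeg_subset_constRun {h k : ℕ} (hk : k ≤ h) : RplusSeg p h ⊆ constRun p k 1 :=
  fun _ hx => mem_constRun.mpr fun _ hi =>
    quadraticChar_add_natCast_of_mem_RplusSeg hx ((mem_Icc.mp hi).2.trans hk)

lemma mem_constRun_of_mul_eq_add {h k Q q j : ℕ} {x y : ZMod p} (hx : x ∈ RplusSeg p h)
    (hQ : Q * (k + 8) ≤ h) (hq : q ≤ Q) (hq0 : (q : ZMod p) ≠ 0) (hj : j ≤ 8 * Q)
    (hy : (q : ZMod p) * y = x + j) : y ∈ constRun p k 1 ∪ constRun p k (-1) := by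
  have hχ : ∀ i ∈ Icc 1 k,
      quadraticChar (ZMod p) (y + i) = quadraticChar (ZMod p) (q : ZMod p) := by
    intro i hi
    have hjh : j + i * q ≤ h := by
      have : i * q ≤ k * Q := Nat.mul_le_mul (mem_Icc.mp hi).2 hq
      nlinarith
    have h1 := quadraticChar_add_natCast_of_mem_RplusSeg hx hjh
    have h2 : x + ((j + i * q : ℕ) : ZMod p) = q * (y + i) := by
      push_cast
      linear_combination -hy
    rw [h2, map_mul] at h1
    rcases quadraticChar_dichotomy hq0 with h3 | h3 <;> rw [h3] at h1 ⊢ <;> linarith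
  rw [mem_union, mem_constRun, mem_constRun]
  rcases quadraticChar_dichotomy hq0 with h3 | h3
  · exact Or.inl fun i hi => (hχ i hi).trans h3
  · exact Or.inr fun i hi => (hχ i hi).trans h3

lemma succ_pow_five_le {n : ℕ} (hn : 2 ≤ n) : (n + 1) ^ 5 ≤ 16 ^ n := by
  induction n, hn using Nat.le_induction with
  | base => norm_num
  | succ n hn ih =>
    have h1 : (2 * (n + 1 + 1)) ^ 5 ≤ (3 * (n + 1)) ^ 5 := Nat.pow_le_pow_left (by omega) 5
    rw [mul_pow, mul_pow] at h1
    rw [pow_succ 16]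
    omega

/-- A Chebyshev-type lower bound for the prime counting function. -/
lemma le_primeCounting_mul_logb {n : ℕ} (hn : 2 ≤ n) :
    (n : ℝ) ≤ 5 * (Nat.primeCounting n * Real.logb 2 n) := by
  have hn1 : (1 : ℝ) < n := by exact_mod_cast hn
  have hlog2 := Real.log_pos one_lt_two
  have hlogn := Real.log_pos hn1
  have h1 := Chebyshev.pi_ge n
  have h2 : 5 * Real.log (n + 1) ≤ 4 * (n * Real.log 2) := by
    have h3 : ((n : ℝ) + 1) ^ 5 ≤ 2 ^ (4 * n) := by
      rw [pow_mul]
      norm_num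
      exact_mod_cast succ_pow_five_le hn
    have h4 := Real.log_le_log (by positivity) h3
    rw [Real.log_pow, Real.log_pow] at h4
    push_cast at h4
    linarith
  rw [div_le_iff₀ hlogn] at h1
  rw [Real.logb, mul_div_assoc', mul_div_assoc', le_div_iff₀ hlog2]
  linarith

lemma natLog_le_logb (p : ℕ) : (Nat.log 2 p : ℝ) ≤ Real.logb 2 p := by
  exact_mod_cast Real.natLog_le_logb p 2

lemma logb_le_natLog_add_one {p : ℕ} (hp : 2 ≤ p) : Real.logb 2 p ≤ Nat.log 2 p + 1 := by
  have hp0 : (0 : ℝ) < p := by exact_mod_cast (by omega : 0 < p)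
  rw [Real.logb_le_iff_le_rpow one_lt_two hp0]
  have := (Nat.lt_pow_succ_log_self one_lt_two p).le
  exact_mod_cast this

lemma card_RplusSeg_le {h : ℕ} (hp : p ≠ 2) (hh : Real.logb 2 p ≤ h) :
    (#(RplusSeg p h) : ℝ) ≤ 83 * Real.logb 2 p * √p := by
  have hk := natLog_le_logb p
  have hkh : Nat.log 2 p ≤ h := by exact_mod_cast hk.trans hh
  calc (#(RplusSeg p h) : ℝ) ≤ #(constRun p (Nat.log 2 p) 1) := by
        exact_mod_cast card_le_card (RplusSeg_subset_constRun hkh)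
    _ ≤ 83 * Nat.log 2 p * √p := card_constRun_log_le hp (Or.inl rfl)
    _ ≤ _ := by gcongr

/-- The estimate for long segments, obtained by comparing the dilates of `RplusSeg p h` by primes
with the set of runs on which the quadratic character is constant. -/
lemma card_RplusSeg_mul_le_of_two_le {h : ℕ} (hp : p ≠ 2) (hhp : h < p)
    (hQ : 2 ≤ h / (Nat.log 2 p + 8)) :
    (#(RplusSeg p h) * h : ℝ) ≤
      10 ^ 10 * √p * Real.logb 2 p ^ 3 * max 1 (Real.logb 2 (4 * h / Real.logb 2 p)) := by
  have hp2 : 2 ≤ p := (Fact.out : p.Prime).two_le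
  set k := Nat.log 2 p with hk
  set L := Real.logb 2 p with hL
  set S := RplusSeg p h with hS
  set Q := h / (k + 8) with hQdef
  set M := max 1 (Real.logb 2 (4 * h / L)) with hM
  have hp0 : (0 : ℝ) < p := by exact_mod_cast (by omega : 0 < p)
  have hk1 : 1 ≤ k := Nat.log_pos one_lt_two hp2
  have hkL : (k : ℝ) ≤ L := natLog_le_logb p
  have hLk : L ≤ k + 1 := logb_le_natLog_add_one hp2
  have hL1 : 1 ≤ L := le_trans (by exact_mod_cast hk1) hkL
  have hM1 : 1 ≤ M := le_max_left _ _
  have hQh : Q * (k + 8) ≤ h := Nat.div_mul_le_self _ _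
  have hQp : 9 * Q < p := by nlinarith
  set T := constRun p k 1 ∪ constRun p k (-1) with hT
  have hTcard : (#T : ℝ) ≤ 166 * L * √p := by
    have h1 := card_constRun_log_le (p := p) (ε := 1) hp (Or.inl rfl)
    have h2 := card_constRun_log_le (p := p) (ε := -1) hp (Or.inr rfl)
    have h3 : (#T : ℝ) ≤ #(constRun p k 1) + #(constRun p k (-1)) := by
      exact_mod_cast card_union_le _ _
    calc (#T : ℝ) ≤ 166 * k * √p := by linarith
      _ ≤ _ := by gcongr
  have hSp : (#S : ℝ) ≤ p := by
    have := card_le_univ S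
    rw [ZMod.card] at this
    exact_mod_cast this
  have hhp' : (h : ℝ) ≤ p := by exact_mod_cast hhp.le
  have hsq : √(p : ℝ) * √p = p := Real.mul_self_sqrt hp0.le
  have hsp : 0 < √(p : ℝ) := Real.sqrt_pos.mpr hp0
  rcases lt_or_ge (p : ℝ) (8 * #T) with hbig | hsmall
  · have hsmallp : √(p : ℝ) ≤ 1328 * L := by
      refine le_of_mul_le_mul_right ?_ hsp
      linarith
    calc (#S * h : ℝ) ≤ p * p := by gcongr
      _ = √p * √p ^ 3 := by nth_rewrite 1 2 [← hsq]; ring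
      _ ≤ √p * (1328 * L) ^ 3 := by gcongr
      _ = 1328 ^ 3 * √p * L ^ 3 * 1 := by ring
      _ ≤ 10 ^ 10 * √p * L ^ 3 * M := by gcongr; norm_num
  · set P := Nat.primesLE Q with hP
    have hPprime : ∀ q ∈ P, q.Prime := fun q hq => (Nat.mem_primesLE.mp hq).2
    have hPQ : ∀ q ∈ P, q ≤ Q := fun q hq => (Nat.mem_primesLE.mp hq).1
    have hmain := card_mul_card_le_of_dilates_subset (p := p) (by omega : 1 ≤ Q) (by omega)
      hPprime hPQ S T fun x hx q hq j hj y hy => by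
        refine mem_constRun_of_mul_eq_add hx hQh (hPQ q hq) ?_ hj hy
        rw [Ne, ZMod.natCast_eq_zero_iff]
        have := hPQ q hq
        exact Nat.not_dvd_of_pos_of_lt (hPprime q hq).pos (by omega)
    have hPS : (#P * #S : ℝ) ≤ 1328 * L ^ 2 * √p := by
      have h1 : 4 * #T * (#P * #S / p : ℝ) ≤ #P * #S / 2 := by
        rw [mul_div_assoc', div_le_div_iff₀ hp0 two_pos]
        have : (0 : ℝ) ≤ #P * #S := by positivity
        nlinarith
      have h2 : (#T * k : ℝ) ≤ 166 * L * √p * L := by gcongr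
      linarith
    have hQM : Real.logb 2 Q ≤ M := by
      refine le_trans (Real.logb_le_logb_of_le one_lt_two ?_ ?_) (le_max_right _ _)
      · exact_mod_cast (by omega : 0 < Q)
      · rw [le_div_iff₀ (by linarith)]
        have h1 : (Q * (k + 8) : ℝ) ≤ h := by exact_mod_cast hQh
        have h2 : (Q * L : ℝ) ≤ Q * (k + 8) := by gcongr; linarith
        have h3 : (0 : ℝ) ≤ h := by positivity
        linarith
    have hQP : (Q : ℝ) ≤ 5 * (#P * M) := by
      refine (le_primeCounting_mul_logb hQ).trans ?_
      rw [hP, Nat.primesLE_card_eq_primeCounting]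
      gcongr
    have hhQ : (h : ℝ) ≤ 18 * L * Q := by
      have h1 : h ≤ 2 * Q * (k + 8) := by
        have := Nat.lt_div_mul_add (a := h) (b := k + 8) (by omega)
        rw [← hQdef] at this
        nlinarith
      have h2 : (h : ℝ) ≤ 2 * Q * (k + 8) := by exact_mod_cast h1
      have h3 : (2 * Q * (k + 8) : ℝ) ≤ 2 * Q * (9 * L) := by gcongr; linarith
      linarith
    calc (#S * h : ℝ) ≤ #S * (18 * L * (5 * (#P * M))) := by
          refine mul_le_mul_of_nonneg_left (hhQ.trans ?_) (Nat.cast_nonneg _)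
          gcongr
      _ = 90 * L * M * (#P * #S) := by ring
      _ ≤ 90 * L * M * (1328 * L ^ 2 * √p) := by gcongr
      _ = 119520 * √p * L ^ 3 * M := by ring
      _ ≤ 10 ^ 10 * √p * L ^ 3 * M := by gcongr; norm_num

end Main

theorem stmt2 :
    ∃ c : ℝ, 0 < c ∧
      ∀ (p : ℕ) [Fact p.Prime] (h : ℕ),
        (h : ℝ) ≥ 2 * Real.logb 2 p →
        ((RplusSeg p h).card : ℝ) ≤
          c * Real.sqrt p * (Real.logb 2 p) ^ 2 *
            (Real.logb 2 (4 * h / Real.logb 2 p)) ^ 2 * deltaP p h / h := by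
  refine ⟨10 ^ 10, by norm_num, fun p _ h hh => ?_⟩
  have hp2 : 2 ≤ p := (Fact.out : p.Prime).two_le
  have hk1 : 1 ≤ Nat.log 2 p := Nat.log_pos one_lt_two hp2
  have hkL := natLog_le_logb p
  have hL1 : 1 ≤ Real.logb 2 p := le_trans (by exact_mod_cast hk1) hkL
  have hδ0 : 0 ≤ deltaP p h := by unfold deltaP; split_ifs <;> positivity
  rcases le_or_gt p h with hph | hph
  · rw [RplusSeg_eq_empty_of_le hph, card_empty, Nat.cast_zero]
    positivity
  have hshort : Real.logb 2 p ≤ h := by linarith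
  have hp : p ≠ 2 := by
    rintro rfl
    have : (h : ℝ) < 2 := by exact_mod_cast hph
    linarith
  have hcard := card_RplusSeg_le hp hshort
  have hlong := card_RplusSeg_mul_le_of_two_le hp hph
  set L := Real.logb 2 p with hL
  set M := Real.logb 2 (4 * h / L) with hM
  have hh0 : (0 : ℝ) < h := by linarith
  have hM1 : 1 ≤ M := by
    rw [hM, Real.le_logb_iff_rpow_le one_lt_two (by positivity), Real.rpow_one,
      le_div_iff₀ (by linarith)]
    linarith
  rw [max_eq_right hM1] at hlong
  have hM2 : M ≤ M ^ 2 := by nlinarith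
  have hM2' : 1 ≤ M ^ 2 := hM1.trans hM2
  rw [deltaP, le_div_iff₀ hh0]
  split_ifs with hδ hδ
  · calc (#(RplusSeg p h) * h : ℝ) ≤ 83 * L * √p * (2 * L) := by gcongr
      _ = 166 * √p * L ^ 2 * 1 * 1 := by ring
      _ ≤ 10 ^ 10 * √p * L ^ 2 * M ^ 2 * 1 := by gcongr; norm_num
  · calc (#(RplusSeg p h) * h : ℝ) ≤ 83 * L * √p * h := by gcongr
      _ = 83 * √p * L ^ 2 * 1 * (h / L) := by field_simp
      _ ≤ 10 ^ 10 * √p * L ^ 2 * M ^ 2 * (h / L) := by gcongr; norm_num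
  · rcases le_or_gt 2 (h / (Nat.log 2 p + 8)) with hQ | hQ
    · calc (#(RplusSeg p h) * h : ℝ) ≤ 10 ^ 10 * √p * L ^ 3 * M := hlong hQ
        _ ≤ 10 ^ 10 * √p * L ^ 3 * M ^ 2 := by gcongr
        _ = 10 ^ 10 * √p * L ^ 2 * M ^ 2 * L := by ring
    · have hh18 : (h : ℝ) ≤ 18 * L := by
        have h1 : h ≤ 2 * (Nat.log 2 p + 8) := ((Nat.div_lt_iff_lt_mul (by omega)).mp hQ).le
        have h2 : (h : ℝ) ≤ 2 * (Nat.log 2 p + 8) := by exact_mod_cast h1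
        linarith
      calc (#(RplusSeg p h) * h : ℝ) ≤ 83 * L * √p * (18 * L) := by gcongr
        _ = 1494 * √p * L ^ 2 * 1 * 1 := by ring
        _ ≤ 10 ^ 10 * √p * L ^ 2 * M ^ 2 * L := by gcongr; norm_num
end

section
/- There is an absolute constant c > 0 with the following property. Let p be a prime, let h_* and h be integers with 2 ≤ h_* ≤ h and 8·h_*·h < p, let Q ⊆ F_p be the image modulo p of the set of prime numbers in the interval [h_*/2, h_*], let S ⊆ F_p be a set such that the sumset A := {1,…,h} + S is direct (|A| = h·|S|). Then E^×(Q, A) ≤ c·( |Q|²·|A|²/p + |Q|·|A|·min{ h_*/log h_* , (log p)/log h_* } ). -/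
open Finset Pointwise

/-- The multiplicative energy `E^×(Q, A)`: the number of quadruples
`(q₁, q₂, a₁, a₂) ∈ Q × Q × A × A` with `q₁·a₂ = q₂·a₁`. -/
def mulEnergyQA (p : ℕ) [Fact p.Prime] (Q A : Finset (ZMod p)) : ℕ :=
  (((Q ×ˢ Q) ×ˢ A ×ˢ A).filter fun z => z.1.1 * z.2.2 = z.1.2 * z.2.1).card

open ZMod (stdAddChar)

section Fourier

variable {p : ℕ} [Fact p.Prime]

/-- Parseval's identity on `ZMod p`. -/
theorem sum_norm_sq_sum_mul_stdAddChar (f : ZMod p → ℂ) :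
    ∑ x, ‖∑ n, f n * stdAddChar (n * x)‖ ^ 2 = p * ∑ n, ‖f n‖ ^ 2 := by
  have key : (∑ x : ZMod p, ((‖∑ n, f n * stdAddChar (n * x)‖ ^ 2 : ℝ) : ℂ))
      = ((p * ∑ n, ‖f n‖ ^ 2 : ℝ) : ℂ) := by
    have expand : ∀ x : ZMod p, ((‖∑ n, f n * stdAddChar (n * x)‖ ^ 2 : ℝ) : ℂ)
        = ∑ n, ∑ m, f n * (starRingEnd ℂ) (f m) * stdAddChar (x * (n - m)) := by
      intro x
      rw [Complex.ofReal_pow, ← Complex.mul_conj', map_sum, sum_mul_sum]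
      refine sum_congr rfl fun n _ => sum_congr rfl fun m _ => ?_
      rw [map_mul (starRingEnd ℂ), ← AddChar.map_neg_eq_conj,
        show x * (n - m) = n * x + -(m * x) by ring, AddChar.map_add_eq_mul]
      ring
    simp_rw [expand]
    rw [sum_comm]
    push_cast
    rw [mul_sum]
    refine sum_congr rfl fun n _ => ?_
    rw [sum_comm]
    simp_rw [← mul_sum, AddChar.sum_mulShift _ (ZMod.isPrimitive_stdAddChar p), sub_eq_zero]
    simp only [ZMod.card, Nat.cast_ite, Nat.cast_zero, mul_ite, mul_zero, sum_ite_eq, mem_univ,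
      if_true]
    rw [Complex.mul_conj', mul_comm]
  exact_mod_cast key

/-- There is little cancellation in a sum of values of the standard character at points close
to `0`. -/
theorem half_card_le_norm_sum_stdAddChar {ι : Type*} (T : Finset ι) (f : ι → ℤ)
    (hf : ∀ t ∈ T, 8 * |f t| ≤ p) :
    (#T : ℝ) / 2 ≤ ‖∑ t ∈ T, stdAddChar (f t : ZMod p)‖ := by
  have hp : (0 : ℝ) < p := by exact_mod_cast (Fact.out : p.Prime).pos
  refine le_trans ?_ (Complex.re_le_norm _)
  rw [Complex.re_sum, div_eq_mul_one_div, ← nsmul_eq_mul]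
  refine card_nsmul_le_sum _ _ _ fun t ht => ?_
  have hre : (stdAddChar (f t : ZMod p)).re = Real.cos (2 * Real.pi * f t / p) := by
    rw [ZMod.stdAddChar_coe, ← Complex.exp_ofReal_mul_I_re]
    congr 2
    push_cast
    ring
  have hft : 8 * |(f t : ℝ)| ≤ p := by exact_mod_cast hf t ht
  rw [hre, ← Real.cos_pi_div_three, ← Real.cos_abs (2 * Real.pi * f t / p)]
  refine Real.cos_le_cos_of_nonneg_of_le_pi (abs_nonneg _) (by linarith [Real.pi_pos]) ?_
  rw [abs_div, abs_mul, abs_of_pos Real.two_pi_pos, abs_of_pos hp, div_le_iff₀ hp]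
  nlinarith [Real.pi_pos, abs_nonneg (f t : ℝ)]

/-- Mean square of a sum of dilates of a trigonometric polynomial, when each nonzero frequency
comes from at most `M` of the dilates. -/
theorem sum_norm_sq_sum_dilates_le (Q : Finset (ZMod p)) (hQ : 0 ∉ Q) (b : ZMod p → ℂ) (M : ℝ)
    (hM : ∀ n ≠ 0, (#{q ∈ Q | b (n * q⁻¹) ≠ 0} : ℝ) ≤ M) :
    ∑ x, ‖∑ q ∈ Q, ∑ k, b k * stdAddChar (k * (q * x))‖ ^ 2
      ≤ p * ((#Q : ℝ) ^ 2 * ‖b 0‖ ^ 2 + M * (#Q * ∑ k, ‖b k‖ ^ 2)) := by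
  have hM0 : 0 ≤ M := (Nat.cast_nonneg _).trans (hM 1 one_ne_zero)
  have hne : ∀ q ∈ Q, q ≠ 0 := fun q hq h => hQ (h ▸ hq)
  have reindex : ∀ x : ZMod p, ∑ q ∈ Q, ∑ k, b k * stdAddChar (k * (q * x))
      = ∑ n, (∑ q ∈ Q, b (n * q⁻¹)) * stdAddChar (n * x) := by
    intro x
    simp_rw [sum_mul]
    rw [sum_comm (s := univ)]
    refine sum_congr rfl fun q hq => ?_
    refine Fintype.sum_equiv (Equiv.mulRight₀ q (hne q hq)) _ _ fun k => ?_
    simp [mul_assoc, hne q hq]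
  simp_rw [reindex]
  rw [sum_norm_sq_sum_mul_stdAddChar]
  refine mul_le_mul_of_nonneg_left ?_ (Nat.cast_nonneg _)
  have bound : ∀ n : ZMod p, ‖∑ q ∈ Q, b (n * q⁻¹)‖ ^ 2
      ≤ (if n = 0 then (#Q : ℝ) ^ 2 * ‖b 0‖ ^ 2 else 0) + M * ∑ q ∈ Q, ‖b (n * q⁻¹)‖ ^ 2 := by
    intro n
    split_ifs with h
    · subst h
      simp only [zero_mul, sum_const, nsmul_eq_mul, norm_mul, Complex.norm_natCast, mul_pow]
      exact le_add_of_nonneg_right (by positivity)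
    · rw [zero_add, ← sum_filter_ne_zero (s := Q)]
      calc ‖∑ q ∈ Q with b (n * q⁻¹) ≠ 0, b (n * q⁻¹)‖ ^ 2
          ≤ (∑ q ∈ Q with b (n * q⁻¹) ≠ 0, ‖b (n * q⁻¹)‖) ^ 2 := by
            gcongr
            exact norm_sum_le _ _
        _ ≤ #{q ∈ Q | b (n * q⁻¹) ≠ 0} * ∑ q ∈ Q with b (n * q⁻¹) ≠ 0, ‖b (n * q⁻¹)‖ ^ 2 :=
            sq_sum_le_card_mul_sum_sq
        _ ≤ M * ∑ q ∈ Q, ‖b (n * q⁻¹)‖ ^ 2 := by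
            gcongr
            · exact hM n h
            · exact filter_subset _ _
  refine (sum_le_sum fun n _ => bound n).trans_eq ?_
  rw [sum_add_distrib, sum_ite_eq' univ, if_pos (mem_univ _), ← mul_sum, sum_comm (s := univ)]
  congr 2
  rw [← nsmul_eq_mul, ← sum_const]
  refine sum_congr rfl fun q hq => ?_
  exact (Fintype.sum_equiv (Equiv.mulRight₀ q (hne q hq)) _ _ fun k => by simp [hne q hq]).symm

/-- The number of ways to write `m` as a difference of two elements of `{0, …, N - 1}`. -/
def diffCount (p N : ℕ) (m : ZMod p) : ℕ :=
  #{z ∈ range N ×ˢ range N | (z.1 : ZMod p) - (z.2 : ZMod p) = m}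

theorem diffCount_le {N : ℕ} (hN : N ≤ p) (m : ZMod p) : diffCount p N m ≤ N := by
  rw [diffCount]
  conv_rhs => rw [← card_range N]
  refine card_le_card_of_injOn Prod.fst (fun z hz => ?_) fun z hz w hw h => ?_
  · simp only [coe_filter, mem_product, Set.mem_ofPred_eq] at hz
    exact hz.1.1
  · simp only [coe_filter, mem_product, mem_range, Set.mem_ofPred_eq] at hz hw
    have hcast : (z.2 : ZMod p) = w.2 := by
      have := hz.2.trans hw.2.symm
      rw [h] at this
      exact sub_right_injective this
    refine Prod.ext h ?_
    rw [ZMod.natCast_eq_natCast_iff', Nat.mod_eq_of_lt (by omega), Nat.mod_eq_of_lt (by omega)]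
      at hcast
    exact hcast

theorem exists_intCast_of_diffCount_ne_zero {N : ℕ} {m : ZMod p} (hm : diffCount p N m ≠ 0) :
    ∃ k : ℤ, (k : ZMod p) = m ∧ |k| < N := by
  obtain ⟨z, hz⟩ := card_ne_zero.1 hm
  simp only [mem_filter, mem_product, mem_range] at hz
  refine ⟨z.1 - z.2, by simpa using hz.2, ?_⟩
  rw [abs_lt]
  omega

/-- The Fourier expansion of the Fejér kernel. -/
theorem norm_sq_sum_stdAddChar_eq_sum_diffCount (N : ℕ) (x : ZMod p) :
    ((‖∑ k ∈ range N, stdAddChar ((k : ZMod p) * x)‖ ^ 2 : ℝ) : ℂ)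
      = ∑ m, (diffCount p N m : ℂ) * stdAddChar (m * x) := by
  rw [Complex.ofReal_pow, ← Complex.mul_conj', map_sum, sum_mul_sum, ← sum_product',
    ← sum_fiberwise (g := fun z : ℕ × ℕ => (z.1 : ZMod p) - (z.2 : ZMod p))]
  refine sum_congr rfl fun m _ => ?_
  rw [diffCount, ← nsmul_eq_mul, ← sum_const]
  refine sum_congr rfl fun z hz => ?_
  rw [← (mem_filter.1 hz).2, ← AddChar.map_neg_eq_conj, ← AddChar.map_add_eq_mul]
  congr 1
  ring

end Fourier

section Energy

variable {p : ℕ} [Fact p.Prime]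

theorem mulEnergyQA_le_sum_sq (Q A : Finset (ZMod p)) (hQ : 0 ∉ Q) :
    mulEnergyQA p Q A ≤ ∑ x, #{q ∈ Q | q * x ∈ A} ^ 2 := by
  have hne : ∀ q ∈ Q, q ≠ 0 := fun q hq h => hQ (h ▸ hq)
  have hcard : ∑ x, #{q ∈ Q | q * x ∈ A} ^ 2
      = #((univ : Finset (ZMod p)).sigma
          fun x => {q ∈ Q | q * x ∈ A} ×ˢ {q ∈ Q | q * x ∈ A}) := by
    simp [card_sigma, card_product, sq]
  rw [hcard, mulEnergyQA]
  refine card_le_card_of_injOn (fun z => ⟨z.2.1 * z.1.1⁻¹, z.1⟩) ?_ ?_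
  · rintro ⟨⟨q₁, q₂⟩, a₁, a₂⟩ hz
    simp only [coe_filter, mem_product, Set.mem_ofPred_eq] at hz
    obtain ⟨⟨⟨h1, h2⟩, h3, h4⟩, h5⟩ := hz
    have e1 : q₁ * (a₁ * q₁⁻¹) = a₁ := by field_simp [hne _ h1]
    have e2 : q₂ * (a₁ * q₁⁻¹) = a₂ := by
      rw [← mul_assoc, ← h5, mul_right_comm, mul_inv_cancel₀ (hne _ h1), one_mul]
    simp only [coe_sigma, Set.mem_sigma_iff, coe_univ, Set.mem_univ, true_and, mem_coe,
      mem_product, mem_filter, e1, e2]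
    exact ⟨⟨h1, h3⟩, h2, h4⟩
  · rintro ⟨⟨q₁, q₂⟩, a₁, a₂⟩ hz ⟨⟨r₁, r₂⟩, b₁, b₂⟩ hw h
    simp only [coe_filter, mem_product, Set.mem_ofPred_eq] at hz hw
    simp only [Sigma.mk.injEq, heq_eq_eq, Prod.mk.injEq] at h
    obtain ⟨h, rfl, rfl⟩ := h
    have h1 := hne _ hz.1.1.1
    obtain rfl : a₁ = b₁ := mul_right_cancel₀ (inv_ne_zero h1) h
    obtain rfl : a₂ = b₂ := mul_left_cancel₀ h1 (hz.2.trans hw.2.symm)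
    rfl

theorem mulEnergyQA_le_card_sq_mul_card (Q A : Finset (ZMod p)) (hQ : 0 ∉ Q) :
    mulEnergyQA p Q A ≤ #Q ^ 2 * #A := by
  rw [mulEnergyQA, sq, ← card_product, ← card_product]
  refine card_le_card_of_injOn (fun z => (z.1, z.2.1)) ?_ ?_
  · rintro ⟨⟨q₁, q₂⟩, a₁, a₂⟩ hz
    simp only [coe_filter, mem_product, Set.mem_ofPred_eq] at hz
    simp [hz]
  · rintro ⟨⟨q₁, q₂⟩, a₁, a₂⟩ hz ⟨⟨r₁, r₂⟩, b₁, b₂⟩ hw h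
    simp only [coe_filter, mem_product, Set.mem_ofPred_eq] at hz hw
    simp only [Prod.mk.injEq] at h
    obtain ⟨⟨rfl, rfl⟩, rfl⟩ := h
    have h1 : q₁ ≠ 0 := fun h => hQ (h ▸ hz.1.1.1)
    obtain rfl : a₂ = b₂ := mul_left_cancel₀ h1 (hz.2.trans hw.2.symm)
    rfl

end Energy

section Primes

/-- The primes in `[H / 2, H]`. -/
def dyadicPrimes (H : ℕ) : Finset ℕ := (Icc 1 H).filter fun q => q.Prime ∧ H ≤ 2 * q

theorem pow_card_le_sq_prod {H : ℕ} {T : Finset ℕ} (hT : T ⊆ dyadicPrimes H) :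
    H ^ #T ≤ (∏ q ∈ T, q) ^ 2 := by
  rw [← prod_const, ← prod_pow]
  refine prod_le_prod' fun q hq => ?_
  have h := (mem_filter.1 (hT hq)).2
  nlinarith [h.1.two_le, h.2]

theorem card_mul_logb_le {H : ℕ} (hH : 2 ≤ H) {T : Finset ℕ} (hT : T ⊆ dyadicPrimes H) {y : ℝ}
    (hy : ((∏ q ∈ T, q : ℕ) : ℝ) ≤ y) : (#T : ℝ) * Real.logb 2 H ≤ 2 * Real.logb 2 y := by
  have hpos : 0 < ∏ q ∈ T, q :=
    prod_pos fun q hq => (mem_filter.1 (hT hq)).2.1.pos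
  have h1 : ((H : ℝ) ^ #T) ≤ y ^ 2 :=
    le_trans (by exact_mod_cast pow_card_le_sq_prod hT) (pow_le_pow_left₀ (by positivity) hy 2)
  have h2 := Real.logb_le_logb_of_le (b := 2) (by norm_num) (by positivity) h1
  rwa [Real.logb_pow, Real.logb_pow, Nat.cast_ofNat] at h2

/-- A weak form of Chebyshev's upper bound. -/
theorem card_dyadicPrimes_le {H : ℕ} (hH : 2 ≤ H) :
    (#(dyadicPrimes H) : ℝ) ≤ 4 * (H / Real.logb 2 H) := by
  have hlog : 0 < Real.logb 2 H := Real.logb_pos (by norm_num) (by exact_mod_cast hH)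
  have hprod : ∏ q ∈ dyadicPrimes H, q ≤ 4 ^ H := by
    refine le_trans ?_ (primorial_le_four_pow H)
    refine prod_le_prod_of_subset_of_one_le' (fun q hq => ?_) fun q hq _ => ?_
    · simp only [dyadicPrimes, mem_filter, mem_Icc] at hq
      simp only [mem_filter, mem_range]
      exact ⟨by omega, hq.2.1⟩
    · exact (mem_filter.1 hq).2.pos
  have h := card_mul_logb_le hH (y := 4 ^ H) subset_rfl (by exact_mod_cast hprod)
  have h4 : Real.logb 2 (4 ^ H) = 2 * H := by
    rw [show (4 : ℝ) = 2 ^ 2 by norm_num, ← pow_mul, Real.logb_pow, Real.logb_self_eq_one]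
    · push_cast; ring
    · norm_num
  rw [h4] at h
  rw [← mul_div_assoc, le_div_iff₀ hlog]
  linarith

/-- A nonzero residue has few representations as a product of a prime in `[H / 2, H]` and a
small integer. -/
theorem card_prime_factors_le {p H : ℕ} [Fact p.Prime] (hH : 2 ≤ H) {n : ZMod p} (hn : n ≠ 0)
    {T : Finset ℕ} (hT : T ⊆ dyadicPrimes H) {N : ℕ} (hN : 2 * (H * N) ≤ p)
    (hrep : ∀ q ∈ T, ∃ k : ℤ, |k| < N ∧ ((q * k : ℤ) : ZMod p) = n) :
    (#T : ℝ) ≤ 2 * (Real.logb 2 p / Real.logb 2 H) := by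
  have hlog : 0 < Real.logb 2 H := Real.logb_pos (by norm_num) (by exact_mod_cast hH)
  have hp1 : (1 : ℝ) < p := by exact_mod_cast (Fact.out : p.Prime).one_lt
  rcases T.eq_empty_or_nonempty with rfl | ⟨q₀, hq₀⟩
  · have := Real.logb_pos (b := 2) (by norm_num) hp1
    simp only [card_empty, Nat.cast_zero]
    positivity
  have small : ∀ q ∈ T, ∀ k : ℤ, |k| < N → 2 * |(q * k : ℤ)| < p := by
    intro q hq k hk
    have hq' := mem_filter.1 (hT hq)
    have hqH : (q : ℤ) ≤ H := by exact_mod_cast (mem_Icc.1 hq'.1).2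
    have hq0 : (0 : ℤ) < q := by exact_mod_cast hq'.2.1.pos
    have hN' : 2 * ((H : ℤ) * N) ≤ p := by exact_mod_cast hN
    rw [abs_mul, abs_of_pos hq0]
    nlinarith [abs_nonneg k]
  obtain ⟨k₀, hk₀, hn₀⟩ := hrep q₀ hq₀
  set m : ℤ := q₀ * k₀ with hm
  have hm0 : m ≠ 0 := by
    rintro h
    rw [h, Int.cast_zero] at hn₀
    exact hn hn₀.symm
  have hdvd : ∀ q ∈ T, q ∣ m.natAbs := by
    intro q hq
    obtain ⟨k, hk, hqk⟩ := hrep q hq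
    have hmod : (p : ℤ) ∣ m - q * k :=
      (ZMod.intCast_eq_intCast_iff_dvd_sub _ _ _).1 (hqk.trans hn₀.symm)
    have habs : |m - q * k| < p := by
      have h1 := small q hq k hk
      have h2 : 2 * |m| < p := small q₀ hq₀ k₀ hk₀
      have h3 := abs_sub m (q * k)
      omega
    have heq := Int.eq_zero_of_abs_lt_dvd hmod habs
    rw [← Int.natCast_dvd]
    exact ⟨k, by linarith⟩
  have hprod : ∏ q ∈ T, q ≤ p := by
    have h1 := Nat.le_of_dvd (Int.natAbs_pos.2 hm0)
      (prod_primes_dvd m.natAbs (fun q hq => (mem_filter.1 (hT hq)).2.1.prime) hdvd)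
    have h2 : 2 * |m| < p := small q₀ hq₀ k₀ hk₀
    rw [Int.abs_eq_natAbs] at h2
    omega
  have h := card_mul_logb_le hH hT (y := p) (by exact_mod_cast hprod)
  rwa [← mul_div_assoc, le_div_iff₀ hlog]

end Primes

section DirectSum

variable {p : ℕ} [Fact p.Prime]

theorem sum_norm_sq_sum_stdAddChar_neg (A : Finset (ZMod p)) :
    ∑ m : ZMod p, ‖∑ a ∈ A, stdAddChar (a * -m)‖ ^ 2 = p * #A := by
  have h := sum_norm_sq_sum_mul_stdAddChar (p := p) fun n => if n ∈ A then 1 else 0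
  simp only [ite_mul, one_mul, zero_mul, sum_ite_mem, univ_inter] at h
  rw [Fintype.sum_equiv (Equiv.neg (ZMod p)) (fun m => ‖∑ a ∈ A, stdAddChar (a * -m)‖ ^ 2)
    (fun m => ‖∑ a ∈ A, stdAddChar (a * m)‖ ^ 2) fun m => rfl, h]
  congr 1
  simp [apply_ite]

/-- The Fourier coefficients of the sum over `s ∈ S` of the translates by `s` of a Fejér kernel
of degree less than `N`. -/
noncomputable def fejerCoeff (N : ℕ) (S : Finset (ZMod p)) (m : ZMod p) : ℂ :=
  4 / (N : ℂ) ^ 2 * diffCount p N m * ∑ s ∈ S, stdAddChar (s * -m)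

theorem sum_fejerCoeff_mul_stdAddChar (N : ℕ) (S : Finset (ZMod p)) (y : ZMod p) :
    ∑ m, fejerCoeff N S m * stdAddChar (m * y)
      = ((∑ s ∈ S, 4 / (N : ℝ) ^ 2 *
          ‖∑ k ∈ range N, stdAddChar ((k : ZMod p) * (y - s))‖ ^ 2 : ℝ) : ℂ) := by
  rw [Complex.ofReal_sum]
  simp_rw [Complex.ofReal_mul, norm_sq_sum_stdAddChar_eq_sum_diffCount, fejerCoeff, mul_sum,
    sum_mul]
  rw [sum_comm]
  refine sum_congr rfl fun s _ => sum_congr rfl fun m _ => ?_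
  rw [show m * (y - s) = s * -m + m * y by ring, AddChar.map_add_eq_mul]
  push_cast
  ring

/-- The sum of translates of the Fejér kernel majorizes the indicator function of the
corresponding sum of intervals. -/
theorem one_le_sum_fejer {N h : ℕ} (hN : 0 < N) (hNh : 8 * (h * (N - 1)) ≤ p)
    {S : Finset (ZMod p)} {y : ZMod p}
    (hy : y ∈ (Icc 1 h).image (fun j : ℕ => (j : ZMod p)) + S) :
    1 ≤ ∑ s ∈ S, 4 / (N : ℝ) ^ 2 *
      ‖∑ k ∈ range N, stdAddChar ((k : ZMod p) * (y - s))‖ ^ 2 := by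
  obtain ⟨i, hi, s, hs, rfl⟩ := mem_add.1 hy
  obtain ⟨j, hj, rfl⟩ := mem_image.1 hi
  have hN' : (0 : ℝ) < N := by exact_mod_cast hN
  refine le_trans ?_ (single_le_sum (fun s _ => by positivity) hs)
  have hlow := half_card_le_norm_sum_stdAddChar (p := p) (range N) (fun k => (k * j : ℤ)) ?_
  · simp only [card_range, Int.cast_mul, Int.cast_natCast] at hlow
    simp only [add_sub_cancel_right]
    calc (1 : ℝ) = 4 / (N : ℝ) ^ 2 * (N / 2) ^ 2 := by field_simp; norm_num
      _ ≤ _ := by gcongr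
  · intro k hk
    have hk' : k ≤ N - 1 := by have := mem_range.1 hk; omega
    have := Nat.mul_le_mul hk' (mem_Icc.1 hj).2
    rw [abs_of_nonneg (by positivity)]
    have h2 : 8 * (k * j) ≤ p := by nlinarith
    exact_mod_cast h2

theorem norm_fejerCoeff_le {N h : ℕ} (hNp : N ≤ p) (hNh : 8 * (h * (N - 1)) ≤ p)
    (hpN : p ≤ 8 * (h * N)) {S A : Finset (ZMod p)} (hh : h < p)
    (hA : A = (Icc 1 h).image (fun j : ℕ => (j : ZMod p)) + S) (hcard : #A = h * #S)
    (m : ZMod p) :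
    ‖fejerCoeff N S m‖ ≤ 64 / p * ‖∑ a ∈ A, stdAddChar (a * -m)‖ := by
  have hp : (0 : ℝ) < p := by exact_mod_cast (Fact.out : p.Prime).pos
  rcases eq_or_ne (diffCount p N m) 0 with h0 | h0
  · rw [fejerCoeff, h0]
    simp only [Nat.cast_zero, mul_zero, zero_mul, norm_zero]
    positivity
  obtain ⟨k, rfl, hk⟩ := exists_intCast_of_diffCount_ne_zero h0
  have hN : 0 < N := by have := abs_nonneg k; omega
  have hN' : (0 : ℝ) < N := by exact_mod_cast hN
  have hinj : Set.InjOn (fun j : ℕ => (j : ZMod p)) (Icc 1 h : Finset ℕ) := by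
    intro i hi j hj hij
    simp only [coe_Icc, Set.mem_Icc] at hi hj
    simp only [ZMod.natCast_eq_natCast_iff'] at hij
    rwa [Nat.mod_eq_of_lt (by omega), Nat.mod_eq_of_lt (by omega)] at hij
  have hdirect := card_add_iff.1 (show #((Icc 1 h).image (fun j : ℕ => (j : ZMod p)) + S)
      = #((Icc 1 h).image (fun j : ℕ => (j : ZMod p))) * #S by
    rw [← hA, hcard, card_image_of_injOn hinj, Nat.card_Icc, Nat.add_sub_cancel])
  have hfactor : ∑ a ∈ A, (stdAddChar (a * -(k : ZMod p)) : ℂ)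
      = (∑ j ∈ Icc 1 h, stdAddChar ((-(k * j : ℤ) : ℤ) : ZMod p))
        * ∑ s ∈ S, stdAddChar (s * -(k : ZMod p)) := by
    rw [hA, ← image_add_product, sum_image (by simpa using hdirect), sum_product, sum_image hinj,
      sum_mul_sum]
    refine sum_congr rfl fun j _ => sum_congr rfl fun s _ => ?_
    rw [← AddChar.map_add_eq_mul]
    congr 1
    push_cast
    ring
  have hlow := half_card_le_norm_sum_stdAddChar (p := p) (Icc 1 h) (fun j => (-(k * j : ℤ))) ?_
  · rw [Nat.card_Icc, Nat.add_sub_cancel] at hlow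
    have hdiff : (diffCount p N (k : ZMod p) : ℝ) ≤ N := by exact_mod_cast diffCount_le hNp _
    have hpN' : (p : ℝ) ≤ 8 * (h * N) := by exact_mod_cast hpN
    rw [hfactor, norm_mul, fejerCoeff, norm_mul, ← mul_assoc]
    refine mul_le_mul_of_nonneg_right ?_ (norm_nonneg _)
    calc ‖4 / (N : ℂ) ^ 2 * diffCount p N (k : ZMod p)‖
        = 4 / (N : ℝ) ^ 2 * diffCount p N (k : ZMod p) := by simp
      _ ≤ 4 / (N : ℝ) ^ 2 * N := by gcongr
      _ = 4 / N := by field_simp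
      _ ≤ 64 / p * (h / 2) := by
        rw [div_mul_div_comm, div_le_div_iff₀ hN' (by positivity)]
        nlinarith
      _ ≤ _ := by gcongr
  · intro j hj
    have hk' : |k| ≤ (N - 1 : ℕ) := by omega
    have hj' : (j : ℤ) ≤ h := by exact_mod_cast (mem_Icc.1 hj).2
    have hNh' : 8 * ((h : ℤ) * (N - 1 : ℕ)) ≤ p := by exact_mod_cast hNh
    rw [abs_neg, abs_mul, Nat.abs_cast]
    nlinarith [mul_le_mul hk' hj' (by positivity) (by positivity)]

theorem sum_norm_sq_fejerCoeff_le {N : ℕ} {S A : Finset (ZMod p)}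
    (hcoeff : ∀ m, ‖fejerCoeff N S m‖ ≤ 64 / p * ‖∑ a ∈ A, stdAddChar (a * -m)‖) :
    ∑ m, ‖fejerCoeff N S m‖ ^ 2 ≤ 4096 * (#A / p) := by
  have hp : (0 : ℝ) < p := by exact_mod_cast (Fact.out : p.Prime).pos
  calc ∑ m, ‖fejerCoeff N S m‖ ^ 2
      ≤ ∑ m, (64 / (p : ℝ) * ‖∑ a ∈ A, stdAddChar (a * -m)‖) ^ 2 :=
        sum_le_sum fun m _ => pow_le_pow_left₀ (norm_nonneg _) (hcoeff m) 2
    _ = (64 / (p : ℝ)) ^ 2 * (p * #A) := by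
        simp_rw [mul_pow, ← mul_sum]
        rw [sum_norm_sq_sum_stdAddChar_neg]
    _ = 4096 * (#A / p) := by field_simp; ring

theorem mulEnergyQA_dyadicPrimes_le {H h : ℕ} (hH : 2 ≤ H) (hHh : H ≤ h) (hp : 8 * H * h < p)
    {S Q A : Finset (ZMod p)} (hQ : Q = (dyadicPrimes H).image (fun q : ℕ => (q : ZMod p)))
    (hQ0 : 0 ∉ Q) (hA : A = (Icc 1 h).image (fun j : ℕ => (j : ZMod p)) + S)
    (hcard : #A = h * #S) :
    (mulEnergyQA p Q A : ℝ) ≤ 8192 * ((#Q : ℝ) ^ 2 * (#A : ℝ) ^ 2 / p +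
      #Q * #A * (Real.logb 2 p / Real.logb 2 H)) := by
  have hp0 : (0 : ℝ) < p := by exact_mod_cast (Fact.out : p.Prime).pos
  obtain ⟨K, hK⟩ : ∃ K, p / (8 * h) = K := ⟨_, rfl⟩
  have hKle : 8 * h * K ≤ p := hK ▸ Nat.mul_div_le _ _
  have hltK : p < 8 * h * (K + 1) := by
    rw [← hK, mul_comm]
    exact Nat.lt_mul_of_div_lt (Nat.lt_succ_self _) (by omega)
  have hHK : H ≤ K := hK ▸ (Nat.le_div_iff_mul_le (by omega)).2 (by nlinarith)
  have hhp : h < p := by nlinarith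
  set b : ZMod p → ℂ := fejerCoeff (K + 1) S with hb
  have hNp : K + 1 ≤ p := by nlinarith
  have hcoeff : ∀ m, ‖b m‖ ≤ 64 / p * ‖∑ a ∈ A, stdAddChar (a * -m)‖ :=
    norm_fejerCoeff_le hNp (by rw [Nat.add_sub_cancel]; linarith) (by linarith) hhp hA hcard
  have hb0 : ‖b 0‖ ≤ 64 / p * #A := by simpa using hcoeff 0
  have hcount : ∀ x : ZMod p, (#{q ∈ Q | q * x ∈ A} : ℝ)
      ≤ ‖∑ q ∈ Q, ∑ k, b k * stdAddChar (k * (q * x))‖ := by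
    intro x
    simp_rw [hb, sum_fejerCoeff_mul_stdAddChar]
    rw [← Complex.ofReal_sum, Complex.norm_real]
    refine le_trans ?_ (le_abs_self _)
    rw [card_filter, Nat.cast_sum]
    refine sum_le_sum fun q _ => ?_
    split_ifs with hq
    · rw [Nat.cast_one]
      exact one_le_sum_fejer (N := K + 1) (h := h) K.succ_pos
        (by rw [Nat.add_sub_cancel]; linarith) (hA ▸ hq)
    · rw [Nat.cast_zero]
      positivity
  have hrep : ∀ n ≠ 0, (#{q ∈ Q | b (n * q⁻¹) ≠ 0} : ℝ)
      ≤ 2 * (Real.logb 2 p / Real.logb 2 H) := by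
    intro n hn
    have hle : #{q ∈ Q | b (n * q⁻¹) ≠ 0}
        ≤ #((dyadicPrimes H).filter fun q : ℕ => b (n * (q : ZMod p)⁻¹) ≠ 0) := by
      rw [hQ, filter_image]
      exact card_image_le
    refine le_trans (Nat.cast_le.2 hle) ?_
    refine card_prime_factors_le hH hn (filter_subset _ _) (N := K + 1) (by nlinarith) ?_
    intro q hq
    obtain ⟨hqP, hbq⟩ := mem_filter.1 hq
    have hq0 : (q : ZMod p) ≠ 0 := by
      rintro h0
      exact hQ0 (h0 ▸ hQ ▸ mem_image_of_mem _ hqP)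
    have hdiff : diffCount p (K + 1) (n * (q : ZMod p)⁻¹) ≠ 0 := by
      rintro h0
      exact hbq (by simp [hb, fejerCoeff, h0])
    obtain ⟨k, hk, hkN⟩ := exists_intCast_of_diffCount_ne_zero hdiff
    refine ⟨k, hkN, ?_⟩
    push_cast
    rw [hk]
    field_simp
  have hM : 0 ≤ Real.logb 2 p / Real.logb 2 H :=
    div_nonneg (Real.logb_nonneg (by norm_num) (by exact_mod_cast (by omega : 1 ≤ p)))
      (Real.logb_nonneg (by norm_num) (by exact_mod_cast (by omega : 1 ≤ H)))
  calc (mulEnergyQA p Q A : ℝ)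
      ≤ ∑ x : ZMod p, (#{q ∈ Q | q * x ∈ A} : ℝ) ^ 2 := by
        exact_mod_cast mulEnergyQA_le_sum_sq Q A hQ0
    _ ≤ ∑ x, ‖∑ q ∈ Q, ∑ k, b k * stdAddChar (k * (q * x))‖ ^ 2 :=
        sum_le_sum fun x _ => pow_le_pow_left₀ (Nat.cast_nonneg _) (hcount x) 2
    _ ≤ p * ((#Q : ℝ) ^ 2 * ‖b 0‖ ^ 2
          + 2 * (Real.logb 2 p / Real.logb 2 H) * (#Q * ∑ k, ‖b k‖ ^ 2)) :=
        sum_norm_sq_sum_dilates_le Q hQ0 b _ hrep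
    _ ≤ p * ((#Q : ℝ) ^ 2 * (64 / p * #A) ^ 2
          + 2 * (Real.logb 2 p / Real.logb 2 H) * (#Q * (4096 * (#A / p)))) := by
        gcongr
        exact sum_norm_sq_fejerCoeff_le hcoeff
    _ = 4096 * ((#Q : ℝ) ^ 2 * (#A : ℝ) ^ 2 / p)
          + 8192 * (#Q * #A * (Real.logb 2 p / Real.logb 2 H)) := by
        field_simp
        ring
    _ ≤ _ := by
        have : 0 ≤ (#Q : ℝ) ^ 2 * (#A : ℝ) ^ 2 / p := by positivity
        linarith

end DirectSum

theorem stmt4 :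
    ∃ c : ℝ, 0 < c ∧
      ∀ (p : ℕ) [Fact p.Prime] (hstar h : ℕ) (S : Finset (ZMod p)),
        2 ≤ hstar → hstar ≤ h → 8 * hstar * h < p →
        ∀ Q A : Finset (ZMod p),
          Q = ((Finset.Icc 1 hstar).filter fun q => q.Prime ∧ hstar ≤ 2 * q).image
                (fun q : ℕ => (q : ZMod p)) →
          A = (Finset.Icc 1 h).image (fun j : ℕ => (j : ZMod p)) + S →
          A.card = h * S.card →
          (mulEnergyQA p Q A : ℝ) ≤
            c * ((Q.card : ℝ) ^ 2 * (A.card : ℝ) ^ 2 / p +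
              (Q.card : ℝ) * (A.card : ℝ) *
                min ((hstar : ℝ) / Real.logb 2 hstar) (Real.logb 2 p / Real.logb 2 hstar)) := by
  refine ⟨8192, by norm_num, ?_⟩
  intro p _ H h S hH hHh hp Q A hQ hA hcard
  change Q = (dyadicPrimes H).image (fun q : ℕ => (q : ZMod p)) at hQ
  have hQ0 : 0 ∉ Q := by
    rw [hQ, mem_image]
    rintro ⟨q, hq, h0⟩
    have hq1 := mem_Icc.1 (mem_filter.1 hq).1
    have := Nat.le_of_dvd hq1.1 ((ZMod.natCast_eq_zero_iff q p).1 h0)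
    nlinarith
  have hQcard : (#Q : ℝ) ≤ 4 * (H / Real.logb 2 H) :=
    le_trans (Nat.cast_le.2 (hQ ▸ card_image_le)) (card_dyadicPrimes_le hH)
  rcases min_choice ((H : ℝ) / Real.logb 2 H) (Real.logb 2 p / Real.logb 2 H) with hmin | hmin
  · rw [hmin]
    have hE : (mulEnergyQA p Q A : ℝ) ≤ (#Q : ℝ) ^ 2 * #A := by
      exact_mod_cast mulEnergyQA_le_card_sq_mul_card Q A hQ0
    have hmul := mul_le_mul_of_nonneg_left hQcard (by positivity : (0 : ℝ) ≤ #Q * #A)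
    have hsq : 0 ≤ (#Q : ℝ) ^ 2 * (#A : ℝ) ^ 2 / p := by positivity
    have hnn : 0 ≤ (#Q : ℝ) ^ 2 * #A := by positivity
    nlinarith
  · rw [hmin]
    exact mulEnergyQA_dyadicPrimes_le hH hHh hp hQ hQ0 hA hcard
end
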